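/- arXiv:2304.06609 — 2 statements merged into one kernel-verified Lean document; each statement's English description precedes it below -/
import Mathlib

section
/- (Peskine) Let R be a Cohen-Macaulay ring of dimension n with canonical module ω_R, and let M be a finitely generated R-module of dimension d. The following are equivalent: (1) M is sequentially Cohen-Macaulay; (2) Ext_R^{n-i}(M, ω_R) is either 0 or Cohen-Macaulay of dimension i for all i ∈ {0,…,d}; (3) Ext_R^{n-i}(M, ω_R) is either 0 or Cohen-Macaulay of dimension i for all i ∈ {1,…,d−1}. -/
open CategoryTheory

noncomputable section

/-- The (Krull) dimension of a module: the Krull dimension of its support.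
The dimension of the zero module is `⊥` (thought of as `-1`). -/
noncomputable def mDim (R : Type) [CommRing R] (M : Type) [AddCommGroup M] [Module R M] :
    WithBot ℕ∞ :=
  Order.krullDim (Module.support R M)

/-- The `i`-th Ext module `Ext_R^i(A, B)` (as a type). -/
noncomputable abbrev extC (R : Type) [CommRing R] (i : ℕ) (A B : Type)
    [AddCommGroup A] [Module R A] [AddCommGroup B] [Module R B] : Type :=
  ↥(((Ext R (ModuleCat R) i).obj (Opposite.op (ModuleCat.of R A))).obj (ModuleCat.of R B))

/-- The depth of a module `M` with respect to an ideal `I`: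
the least `i` such that `Ext_R^i(R/I, M) ≠ 0` (and `⊤` if there is no such `i`,
in particular the depth of the zero module is `⊤ = +∞`). -/
noncomputable def mDepth (R : Type) [CommRing R] (I : Ideal R) (M : Type)
    [AddCommGroup M] [Module R M] : ℕ∞ :=
  sInf {i : ℕ∞ | ∃ j : ℕ, i = j ∧ Nontrivial (extC R j (R ⧸ I) M)}

/-- `M` is a Cohen-Macaulay module (with respect to the (maximal) ideal `I`) if it is
nonzero and its depth equals its dimension. -/
def IsCM (R : Type) [CommRing R] (I : Ideal R) (M : Type) [AddCommGroup M] [Module R M] :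
    Prop :=
  Nontrivial M ∧ (mDepth R I M : WithBot ℕ∞) = mDim R M

/-- The subquotient `N'/N` of a module (most meaningful when `N ≤ N'`). -/
abbrev subQuot (R : Type) [CommRing R] {M : Type} [AddCommGroup M] [Module R M]
    (N N' : Submodule R M) : Type :=
  N' ⧸ (Submodule.comap N'.subtype N)

/-- `F 0 = 0 ⊊ F 1 ⊊ ⋯ ⊊ F r = M` is a sCM filtration: each quotient `F (i+1) / F i`
is Cohen-Macaulay and the dimensions of the quotients are strictly increasing. -/
def IsSCMFil (R : Type) [CommRing R] (I : Ideal R) {M : Type} [AddCommGroup M] [Module R M]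
    (r : ℕ) (F : ℕ → Submodule R M) : Prop :=
  F 0 = ⊥ ∧ F r = ⊤ ∧ (∀ i < r, F i < F (i + 1)) ∧
    (∀ i < r, IsCM R I (subQuot R (F i) (F (i + 1)))) ∧
    (∀ i, i + 1 < r →
      mDim R (subQuot R (F i) (F (i + 1))) < mDim R (subQuot R (F (i + 1)) (F (i + 2))))

/-- `M` is sequentially Cohen-Macaulay if it admits a sCM filtration. -/
def IsSeqCM (R : Type) [CommRing R] (I : Ideal R) (M : Type) [AddCommGroup M] [Module R M] :
    Prop :=
  ∃ (r : ℕ) (F : ℕ → Submodule R M), IsSCMFil R I r F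

/-- `δ_c(M)`: the largest submodule of `M` of dimension at most `c`. -/
noncomputable def deltaSub (R : Type) [CommRing R] (M : Type) [AddCommGroup M] [Module R M]
    (c : ℕ) : Submodule R M :=
  sSup {N : Submodule R M | mDim R ↥N ≤ (c : WithBot ℕ∞)}

/-- `δ_{c-1}(M)`, with `δ_{-1}(M) = 0`. -/
noncomputable def deltaSubPred (R : Type) [CommRing R] (M : Type) [AddCommGroup M] [Module R M] :
    ℕ → Submodule R M
  | 0 => ⊥
  | (c + 1) => deltaSub R M c

/-- `H^0_I(M)`, the `I`-power-torsion submodule of `M`. -/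
noncomputable def tors (R : Type) [CommRing R] (I : Ideal R) (M : Type) [AddCommGroup M]
    [Module R M] : Submodule R M :=
  ⨆ t : ℕ, Submodule.torsionBySet R M ((I ^ t : Ideal R) : Set R)

end
noncomputable section

/-- A Noetherian local ring `R` is Cohen-Macaulay if it is Cohen-Macaulay as a module
over itself. -/
def IsCMLocalRing (R : Type) [CommRing R] [IsLocalRing R] : Prop :=
  IsCM R (IsLocalRing.maximalIdeal R) R

/-- `ω` is a canonical module of the Cohen-Macaulay Noetherian local ring `R` of Krull
dimension `n`: a finitely generated module such that `Ext_R^i(k, ω)` vanishes for `i ≠ n`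
and is isomorphic to the residue field `k = R/𝔪` for `i = n`. -/
def IsCanonicalModule (R : Type) [CommRing R] [IsLocalRing R]
    (ω : Type) [AddCommGroup ω] [Module R ω] : Prop :=
  Module.Finite R ω ∧
    ∀ i : ℕ,
      (((i : WithBot ℕ∞) = ringKrullDim R) →
        Nonempty (extC R i (R ⧸ IsLocalRing.maximalIdeal R) ω ≃ₗ[R]
          (R ⧸ IsLocalRing.maximalIdeal R))) ∧
      (((i : WithBot ℕ∞) ≠ ringKrullDim R) →
        Subsingleton (extC R i (R ⧸ IsLocalRing.maximalIdeal R) ω))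

end

set_option linter.unusedSectionVars false
namespace Pesk
section bridge
open CategoryTheory Abelian
variable {R : Type} [CommRing R]

/-- The derived-category Ext groups. -/
abbrev X (R : Type) [CommRing R] (j : ℕ) (A B : Type)
    [AddCommGroup A] [Module R A] [AddCommGroup B] [Module R B] : Type :=
  Abelian.Ext (ModuleCat.of R A) (ModuleCat.of R B) j

variable {A Y : ModuleCat.{0} R} (P : ProjectiveResolution A)

open CochainComplex HomComplex in
lemma extMk_zero_iff_zero (f : P.complex.X 0 ⟶ Y) (hf : P.complex.d 1 0 ≫ f = 0) :
    P.extMk f 1 rfl hf = 0 ↔ f = 0 := by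
  constructor
  · intro h
    rw [← P.extEquivCohomologyClass.apply_eq_iff_eq,
      ProjectiveResolution.extEquivCohomologyClass_extMk,
      ProjectiveResolution.extEquivCohomologyClass_zero,
      CohomologyClass.mk_eq_zero_iff] at h
    rw [Cocycle.toSingleMk_mem_coboundaries_iff _ _ _ _ _ 1 (by simp)] at h
    obtain ⟨g, hg⟩ := h
    have hz : Limits.IsZero (P.cochainComplex.X 1) :=
      P.cochainComplex.isZero_of_isStrictlyLE 0 1 (by lia)
    rw [hz.eq_of_src g 0, Limits.comp_zero] at hg
    rw [← cancel_epi (P.cochainComplexXIso (-(0:ℕ)) 0 rfl).hom, ← hg, Limits.comp_zero]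
  · rintro rfl; simp

lemma extMk_zero_iff (n : ℕ) (f : P.complex.X n ⟶ Y)
    (hf : P.complex.d (n+1) n ≫ f = 0) :
    P.extMk f (n+1) rfl hf = 0 ↔ ∃ g : P.complex.X ((ComplexShape.up ℕ).prev n) ⟶ Y,
      P.complex.d n ((ComplexShape.up ℕ).prev n) ≫ g = f := by
  cases n with
  | zero =>
    rw [extMk_zero_iff_zero]
    constructor
    · rintro rfl; exact ⟨0, by simp⟩
    · rintro ⟨g, rfl⟩
      rw [P.complex.shape, Limits.zero_comp]
      simp
  | succ p =>
    rw [P.extMk_eq_zero_iff f _ rfl hf _ (by simp : (ComplexShape.up ℕ).prev (p+1) + 1 = p + 1)]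

lemma extMk_smul_aux {n : ℕ} (r : R) (f : P.complex.X n ⟶ Y)
    (hf : P.complex.d (n+1) n ≫ f = 0) (hf' : P.complex.d (n+1) n ≫ (r • f) = 0) :
    P.extMk (r • f) (n+1) rfl hf' = r • P.extMk f (n+1) rfl hf := by
  rw [Ext.smul_eq_comp_mk₀, P.extMk_comp_mk₀]
  congr 1

/-- map from cocycles to Ext -/
noncomputable def cocMap (Y : ModuleCat.{0} R) (n : ℕ) :
    LinearMap.ker ((P.complex.linearYonedaObj R Y).sc' ((ComplexShape.up ℕ).prev n) n (n+1)).g.hom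
      →ₗ[R] Abelian.Ext A Y n where
  toFun f := P.extMk (f.1 : P.complex.X n ⟶ Y) (n+1) rfl f.2
  map_add' f g := (P.add_extMk _ _ _ _ _ _).symm
  map_smul' r f := extMk_smul_aux P r (f.1 : P.complex.X n ⟶ Y) f.2 _

lemma cocMap_ker (Y : ModuleCat.{0} R) (n : ℕ) : LinearMap.ker (cocMap P Y n) = LinearMap.range
    ((P.complex.linearYonedaObj R Y).sc'
      ((ComplexShape.up ℕ).prev n) n (n+1)).moduleCatToCycles := by
  ext f
  refine (extMk_zero_iff P n (f.1 : P.complex.X n ⟶ Y) f.2).trans ?_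
  rw [LinearMap.mem_range]
  constructor
  · rintro ⟨g, hg⟩
    exact ⟨g, Subtype.ext hg⟩
  · rintro ⟨g, hg⟩
    exact ⟨g, congrArg Subtype.val hg⟩

lemma cocMap_surj (Y : ModuleCat.{0} R) (n : ℕ) : Function.Surjective (cocMap P Y n) := by
  intro a
  obtain ⟨f, hf, rfl⟩ := P.extMk_surjective a (n+1) rfl
  exact ⟨⟨f, hf⟩, rfl⟩

end bridge

open CategoryTheory in
theorem bridge (R : Type) [CommRing R] (j : ℕ) (A B : Type)
    [AddCommGroup A] [Module R A] [AddCommGroup B] [Module R B] :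
    Nonempty (extC R j A B ≃ₗ[R] X R j A B) := by
  let P := projectiveResolution (ModuleCat.of R A)
  let K := P.complex.linearYonedaObj R (ModuleCat.of R B)
  let S := K.sc' ((ComplexShape.up ℕ).prev j) j (j+1)
  have e1 := (P.isoExt (R := R) j (ModuleCat.of R B)).toLinearEquiv
  have e2 := (K.homologyIsoSc' ((ComplexShape.up ℕ).prev j) j (j+1) rfl (by simp)).toLinearEquiv
  have e3 := S.moduleCatHomologyIso.toLinearEquiv
  have e4 : (LinearMap.ker S.g.hom ⧸ LinearMap.range S.moduleCatToCycles) ≃ₗ[R] X R j A B :=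
    (Submodule.quotEquivOfEq _ _ (cocMap_ker P (ModuleCat.of R B) j).symm).trans
      ((cocMap P (ModuleCat.of R B) j).quotKerEquivOfSurjective
        (cocMap_surj P (ModuleCat.of R B) j))
  exact ⟨e1.trans (e2.trans (e3.trans e4))⟩
end Pesk

namespace Pesk
section les
open CategoryTheory Abelian
variable {R : Type} [CommRing R]
variable {A B C : Type} [AddCommGroup A] [Module R A] [AddCommGroup B] [Module R B]
  [AddCommGroup C] [Module R C]
variable {A' B' C' : Type} [AddCommGroup A'] [Module R A'] [AddCommGroup B'] [Module R B']
  [AddCommGroup C'] [Module R C']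
variable (Y : Type) [AddCommGroup Y] [Module R Y]

/-- contravariant functoriality -/
noncomputable def eMap (j : ℕ) (f : A →ₗ[R] B) : X R j B Y →ₗ[R] X R j A Y :=
  (Ext.mk₀ (ModuleCat.ofHom f)).precompOfLinear R (ModuleCat.of R Y) (zero_add j)

lemma eMap_apply (j : ℕ) (f : A →ₗ[R] B) (e : X R j B Y) :
    eMap Y j f e = (Ext.mk₀ (ModuleCat.ofHom f)).comp e (zero_add j) := rfl

lemma eMap_id (j : ℕ) (e : X R j A Y) : eMap Y j (LinearMap.id : A →ₗ[R] A) e = e := by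
  rw [eMap_apply]
  exact Ext.mk₀_id_comp e

lemma eMap_comp (j : ℕ) (g : B →ₗ[R] C) (f : A →ₗ[R] B) (e : X R j C Y) :
    eMap Y j (g ∘ₗ f) e = eMap Y j f (eMap Y j g e) := by
  simp only [eMap_apply]
  rw [Ext.mk₀_comp_mk₀_assoc]
  rfl

lemma eMap_zero (j : ℕ) (e : X R j B Y) : eMap Y j (0 : A →ₗ[R] B) e = 0 := by
  rw [eMap_apply, ModuleCat.ofHom_zero]
  simp

lemma eMap_smul (j : ℕ) (r : R) (f : A →ₗ[R] B) (e : X R j B Y) :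
    eMap Y j (r • f) e = r • eMap Y j f e := by
  rw [eMap_apply, eMap_apply, ← Ext.smul_comp, ← Ext.mk₀_smul]
  rfl

/-- Linear equivalences induce linear equivalences on Ext. -/
noncomputable def eEquiv (j : ℕ) (f : A ≃ₗ[R] B) : X R j B Y ≃ₗ[R] X R j A Y :=
  LinearEquiv.ofLinearMap (eMap Y j f.toLinearMap) (eMap Y j f.symm.toLinearMap)
    (by ext e; simp only [LinearMap.comp_apply, ← eMap_comp]; simp [eMap_id])
    (by ext e; simp only [LinearMap.comp_apply, ← eMap_comp]; simp [eMap_id])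

/-- short complex -/
abbrev sc (f : A →ₗ[R] B) (g : B →ₗ[R] C) (h : Function.Exact f g) :
    ShortComplex (ModuleCat.{0} R) :=
  ModuleCat.shortComplexOfCompEqZero f g h.linearMap_comp_eq_zero

lemma scSE {f : A →ₗ[R] B} {g : B →ₗ[R] C} (h : Function.Exact f g)
    (hf : Function.Injective f) (hg : Function.Surjective g) : (sc f g h).ShortExact :=
  ModuleCat.shortComplex_shortExact _ h hf hg

variable {f : A →ₗ[R] B} {g : B →ₗ[R] C} (h : Function.Exact f g)
    (hf : Function.Injective f) (hg : Function.Surjective g)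

/-- connecting map -/
noncomputable def dl (j : ℕ) : X R j A Y →ₗ[R] X R (j+1) C Y :=
  (scSE h hf hg).extClass.precompOfLinear R (ModuleCat.of R Y) (add_comm 1 j)

lemma dl_apply (j : ℕ) (e : X R j A Y) :
    dl Y h hf hg j e = (scSE h hf hg).extClass.comp e (add_comm 1 j) := rfl

include h hf hg in
lemma ex2 (j : ℕ) : Function.Exact (eMap Y j g) (eMap Y j f) := by
  intro e
  constructor
  · intro he
    obtain ⟨a, ha⟩ := Ext.contravariant_sequence_exact₂ (scSE h hf hg) (ModuleCat.of R Y) e he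
    exact ⟨a, ha⟩
  · rintro ⟨a, rfl⟩
    rw [← eMap_comp, h.linearMap_comp_eq_zero, eMap_zero]

lemma ex1 (j : ℕ) : Function.Exact (eMap Y j f) (dl Y h hf hg j) := by
  intro e
  constructor
  · intro he
    obtain ⟨a, ha⟩ := Ext.contravariant_sequence_exact₁ (scSE h hf hg) (ModuleCat.of R Y) e (add_comm 1 j) he
    exact ⟨a, ha⟩
  · rintro ⟨a, rfl⟩
    rw [dl_apply, eMap_apply]
    exact (scSE h hf hg).extClass_comp_assoc _

lemma ex3 (j : ℕ) : Function.Exact (dl Y h hf hg j) (eMap Y (j+1) g) := by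
  intro e
  constructor
  · intro he
    obtain ⟨a, ha⟩ := Ext.contravariant_sequence_exact₃ (scSE h hf hg) (ModuleCat.of R Y) e he
      (add_comm 1 j)
    exact ⟨a, ha⟩
  · rintro ⟨a, rfl⟩
    rw [dl_apply, eMap_apply]
    exact (scSE h hf hg).comp_extClass_assoc _ _

include hg in
lemma ex0 : Function.Injective (eMap Y 0 g) := by
  have : Epi (ModuleCat.ofHom g) := (ModuleCat.epi_iff_surjective _).2 hg
  exact Ext.precomp_mk₀_injective_of_epi (ModuleCat.of R Y) (ModuleCat.ofHom g)

lemma dl_nat {f' : A' →ₗ[R] B'} {g' : B' →ₗ[R] C'} (h' : Function.Exact f' g')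
    (hf' : Function.Injective f') (hg' : Function.Surjective g')
    (a : A →ₗ[R] A') (b : B →ₗ[R] B') (c : C →ₗ[R] C') (h1 : f' ∘ₗ a = b ∘ₗ f)
    (h2 : g' ∘ₗ b = c ∘ₗ g) (j : ℕ) (e : X R j A' Y) :
    eMap Y (j+1) c (dl Y h' hf' hg' j e) = dl Y h hf hg j (eMap Y j a e) := by
  let φ : sc f g h ⟶ sc f' g' h' :=
    { τ₁ := ModuleCat.ofHom a
      τ₂ := ModuleCat.ofHom b
      τ₃ := ModuleCat.ofHom c
      comm₁₂ := by ext x; exact LinearMap.congr_fun h1 x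
      comm₂₃ := by ext x; exact LinearMap.congr_fun h2 x }
  have := ShortComplex.ShortExact.extClass_naturality (scSE h hf hg) (scSE h' hf' hg') φ
  simp only [eMap_apply, dl_apply]
  rw [← Ext.comp_assoc (a₁₂ := 1) _ _ _ _ _ (by lia), ← Ext.comp_assoc (a₁₂ := 1) _ _ _ _ _ (by lia)]
  congr 1
  exact this.symm

/-! covariant -/
/-- covariant functoriality -/
noncomputable def cMap (j : ℕ) (f : A →ₗ[R] B) : X R j Y A →ₗ[R] X R j Y B :=
  (Ext.mk₀ (ModuleCat.ofHom f)).postcompOfLinear R (ModuleCat.of R Y) (add_zero j)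

lemma cMap_apply (j : ℕ) (f : A →ₗ[R] B) (e : X R j Y A) :
    cMap Y j f e = e.comp (Ext.mk₀ (ModuleCat.ofHom f)) (add_zero j) := rfl

lemma cMap_id (j : ℕ) (e : X R j Y A) : cMap Y j (LinearMap.id : A →ₗ[R] A) e = e := by
  rw [cMap_apply]
  exact Ext.comp_mk₀_id e

lemma cMap_smul (j : ℕ) (r : R) (f : A →ₗ[R] B) (e : X R j Y A) :
    cMap Y j (r • f) e = r • cMap Y j f e := by
  rw [cMap_apply, cMap_apply, ← Ext.comp_smul, ← Ext.mk₀_smul]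
  rfl

/-- covariant connecting map -/
noncomputable def cdl (j : ℕ) : X R j Y C →ₗ[R] X R (j+1) Y A :=
  (scSE h hf hg).extClass.postcompOfLinear R (ModuleCat.of R Y) rfl

lemma cdl_apply (j : ℕ) (e : X R j Y C) :
    cdl Y h hf hg j e = e.comp (scSE h hf hg).extClass rfl := rfl

lemma cMap_comp (j : ℕ) (g : B →ₗ[R] C) (f : A →ₗ[R] B) (e : X R j Y A) :
    cMap Y j (g ∘ₗ f) e = cMap Y j g (cMap Y j f e) := by
  simp only [cMap_apply]
  rw [Ext.comp_assoc_of_third_deg_zero, Ext.mk₀_comp_mk₀]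
  rfl

include h hf hg in
lemma cex2 (j : ℕ) : Function.Exact (cMap Y j f) (cMap Y j g) := by
  intro e
  constructor
  · intro he
    obtain ⟨a, ha⟩ := Ext.covariant_sequence_exact₂ (ModuleCat.of R Y) (scSE h hf hg) e he
    exact ⟨a, ha⟩
  · rintro ⟨a, rfl⟩
    rw [← cMap_comp, h.linearMap_comp_eq_zero, cMap_apply, ModuleCat.ofHom_zero]
    simp

lemma cex3 (j : ℕ) : Function.Exact (cMap Y j g) (cdl Y h hf hg j) := by
  intro e
  constructor
  · intro he
    obtain ⟨a, ha⟩ := Ext.covariant_sequence_exact₃ (ModuleCat.of R Y) (scSE h hf hg) e rfl he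
    exact ⟨a, ha⟩
  · rintro ⟨a, rfl⟩
    rw [cdl_apply, cMap_apply, Ext.comp_assoc_of_second_deg_zero]
    have := (scSE h hf hg).comp_extClass
    exact (congrArg (fun z => a.comp z rfl) this).trans (Ext.comp_zero ..)

lemma cex1 (j : ℕ) : Function.Exact (cdl Y h hf hg j) (cMap Y (j+1) f) := by
  intro e
  constructor
  · intro he
    obtain ⟨a, ha⟩ := Ext.covariant_sequence_exact₁ (ModuleCat.of R Y) (scSE h hf hg) e he rfl
    exact ⟨a, ha⟩
  · rintro ⟨a, rfl⟩
    rw [cdl_apply, cMap_apply, Ext.comp_assoc_of_third_deg_zero]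
    have := (scSE h hf hg).extClass_comp
    exact (congrArg (fun z => a.comp z rfl) this).trans (Ext.comp_zero ..)

include hf in
lemma cex0 : Function.Injective (cMap Y 0 f) := by
  have : Mono (ModuleCat.ofHom f) := (ModuleCat.mono_iff_injective _).2 hf
  exact Ext.postcomp_mk₀_injective_of_mono (ModuleCat.of R Y) (ModuleCat.ofHom f)

/-- Ext^0 = Hom -/
noncomputable def x0 : X R 0 A Y ≃ₗ[R] (A →ₗ[R] Y) :=
  (Ext.linearEquiv₀ (R := R) (X := ModuleCat.of R A) (Y := ModuleCat.of R Y)).trans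
    ModuleCat.homLinearEquiv

instance x_finite [IsNoetherianRing R] [Module.Finite R A] [Module.Finite R Y] (j : ℕ) :
    Module.Finite R (X R j A Y) := inferInstance

end les
end Pesk

namespace Pesk
section dims
variable {R : Type} [CommRing R]
variable {A B C : Type} [AddCommGroup A] [Module R A] [AddCommGroup B] [Module R B]
  [AddCommGroup C] [Module R C]

/-- dimension less than `i` -/
def dlt (R : Type) [CommRing R] (i : ℕ) (M : Type) [AddCommGroup M] [Module R M] : Prop :=
  Module.supportDim R M < (i : WithBot ℕ∞)

lemma dlt_zero : dlt R 0 A ↔ Subsingleton A := by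
  rw [← Module.supportDim_eq_bot_iff_subsingleton R]
  unfold dlt
  constructor
  · intro h
    by_contra h'
    obtain ⟨a, ha⟩ := WithBot.ne_bot_iff_exists.1 h'
    rw [← ha] at h
    have h2 : (a : WithBot ℕ∞) < ((0 : ℕ∞) : WithBot ℕ∞) := h
    rw [WithBot.coe_lt_coe] at h2
    simp at h2
  · intro h
    rw [h]
    exact WithBot.bot_lt_coe _

lemma dlt_mono {i j : ℕ} (h : i ≤ j) (hA : dlt R i A) : dlt R j A :=
  lt_of_lt_of_le hA (by exact_mod_cast h)

lemma dlt_sub [Subsingleton A] (i : ℕ) : dlt R i A :=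
  dlt_mono (Nat.zero_le i) (dlt_zero.2 inferInstance)

lemma dlt_inj {i : ℕ} (f : A →ₗ[R] B) (hf : Function.Injective f) (h : dlt R i B) : dlt R i A :=
  lt_of_le_of_lt (Module.supportDim_le_of_injective f hf) h

lemma dlt_surj {i : ℕ} (f : A →ₗ[R] B) (hf : Function.Surjective f) (h : dlt R i A) : dlt R i B :=
  lt_of_le_of_lt (Module.supportDim_le_of_surjective f hf) h

lemma dlt_equiv {i : ℕ} (f : A ≃ₗ[R] B) (h : dlt R i A) : dlt R i B :=
  dlt_surj f.toLinearMap f.surjective h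

lemma wb_lt_iff (a : WithBot ℕ∞) (i : ℕ) : a < ((i + 1 : ℕ) : WithBot ℕ∞) ↔ a ≤ (i : WithBot ℕ∞) := by
  induction a using WithBot.recBotCoe with
  | bot => simp
  | coe a =>
    have h1 : ((i + 1 : ℕ) : WithBot ℕ∞) = (((i + 1 : ℕ) : ℕ∞) : WithBot ℕ∞) := rfl
    have h2 : ((i : ℕ) : WithBot ℕ∞) = (((i : ℕ) : ℕ∞) : WithBot ℕ∞) := rfl
    rw [h1, h2, WithBot.coe_lt_coe, WithBot.coe_le_coe]
    push_cast
    exact ENat.lt_natCast_add_one_iff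

lemma dlt_succ {i : ℕ} : dlt R (i+1) A ↔ Module.supportDim R A ≤ (i : WithBot ℕ∞) := wb_lt_iff _ _

lemma wb_add_lt (a : WithBot ℕ∞) (i : ℕ) :
    a + 1 < ((i + 1 : ℕ) : WithBot ℕ∞) ↔ a < (i : WithBot ℕ∞) := by
  induction a using WithBot.recBotCoe with
  | bot => simp
  | coe a =>
    have h1 : ((i + 1 : ℕ) : WithBot ℕ∞) = (((i + 1 : ℕ) : ℕ∞) : WithBot ℕ∞) := rfl
    have h2 : ((i : ℕ) : WithBot ℕ∞) = (((i : ℕ) : ℕ∞) : WithBot ℕ∞) := rfl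
    have h3 : (a : WithBot ℕ∞) + 1 = ((a + 1 : ℕ∞) : WithBot ℕ∞) := rfl
    rw [h1, h2, h3, WithBot.coe_lt_coe, WithBot.coe_lt_coe]
    induction a using ENat.recTopCoe with
    | top => simp
    | coe a => norm_cast; lia

lemma dlt_of_support {i : ℕ}
    (h : Module.support R B ⊆ Module.support R A ∪ Module.support R C)
    (hA : dlt R i A) (hC : dlt R i C) : dlt R i B := by
  cases i with
  | zero =>
    rw [dlt_zero] at hA hC ⊢
    rw [← Module.support_eq_empty_iff (R := R)] at hA hC ⊢
    rw [hA, hC] at h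
    simpa using h
  | succ i =>
    rw [dlt_succ] at hA hC ⊢
    refine iSup_le fun p => ?_
    rcases h p.head.2 with hp | hp
    · refine le_trans ?_ hA
      let q : LTSeries (Module.support R A) :=
        ⟨p.length, fun i => ⟨(p i).1, Module.mem_support_mono (p.monotone (Fin.zero_le i)) hp⟩,
          fun i => p.step i⟩
      exact le_iSup (fun q : LTSeries (Module.support R A) => (q.length : WithBot ℕ∞)) q
    · refine le_trans ?_ hC
      let q : LTSeries (Module.support R C) :=
        ⟨p.length, fun i => ⟨(p i).1, Module.mem_support_mono (p.monotone (Fin.zero_le i)) hp⟩,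
          fun i => p.step i⟩
      exact le_iSup (fun q : LTSeries (Module.support R C) => (q.length : WithBot ℕ∞)) q

lemma dlt_exact {i : ℕ} {f : A →ₗ[R] B} {g : B →ₗ[R] C} (h : Function.Exact f g)
    (hA : dlt R i A) (hC : dlt R i C) : dlt R i B := by
  refine dlt_of_support ?_ hA hC
  intro p hp
  rw [Module.mem_support_iff'] at hp
  obtain ⟨b, hb⟩ := hp
  by_cases hc : ∀ r ∉ p.asIdeal, r • g b ≠ 0
  · right
    rw [Module.mem_support_iff']
    exact ⟨g b, hc⟩
  · left
    push Not at hc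
    obtain ⟨s, hs, hs'⟩ := hc
    rw [← map_smul] at hs'
    obtain ⟨a, ha⟩ := (h _).1 hs'
    rw [Module.mem_support_iff']
    refine ⟨a, fun r hr hra => hb (r * s) ?_ ?_⟩
    · exact fun hh => (p.2.mem_or_mem hh).elim hr hs
    · rw [mul_smul, ← ha, ← map_smul, hra, map_zero]

/-- monotone in annihilators -/
lemma dlt_of_ann {i : ℕ} [Module.Finite R A] [Module.Finite R B]
    (h : ∀ r : R, (∀ a : A, r • a = 0) → ∀ b : B, r • b = 0) (hA : dlt R i A) : dlt R i B := by
  have hs : Module.support R B ⊆ Module.support R A := by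
    rw [Module.support_eq_zeroLocus, Module.support_eq_zeroLocus]
    refine PrimeSpectrum.zeroLocus_anti_mono ?_
    intro r hr
    exact Module.mem_annihilator.2 (h r (Module.mem_annihilator.1 hr))
  exact dlt_of_support (C := A) (hs.trans Set.subset_union_left) hA hA

open IsLocalRing
variable [IsNoetherianRing R] [IsLocalRing R]

lemma dlt_of_quot {i : ℕ} {x : R} (hx : x ∈ maximalIdeal R) [Module.Finite R A]
    (h : dlt R i (QuotSMulTop x A)) : dlt R (i+1) A :=
  lt_of_le_of_lt (Module.supportDim_le_supportDim_quotSMulTop_succ hx) ((wb_add_lt _ _).2 h)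

lemma dlt_quot_of {i : ℕ} {x : R} (hx : x ∈ maximalIdeal R) [Module.Finite R A]
    (hreg : IsSMulRegular A x) (h : dlt R (i+1) A) : dlt R i (QuotSMulTop x A) := by
  unfold dlt at h
  rw [← Module.supportDim_quotSMulTop_succ_eq_supportDim hreg hx] at h
  exact (wb_add_lt _ _).1 h

lemma dlt_killed (h : ∀ r ∈ maximalIdeal R, ∀ a : A, r • a = 0) : dlt R 1 A := by
  refine dlt_succ.2 (Order.krullDim_nonpos_iff_forall_isMax.2 ?_)
  intro p q hpq
  have h1 : maximalIdeal R ≤ p.1.asIdeal :=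
    le_trans (fun r hr => Module.mem_annihilator.2 (h r hr))
      (Module.annihilator_le_of_mem_support p.2)
  have h2 : q.1.asIdeal ≤ p.1.asIdeal := le_trans (IsLocalRing.le_maximalIdeal q.1.2.ne_top) h1
  exact h2

/-- Nakayama. -/
lemma nak {x : R} (hx : x ∈ maximalIdeal R) [Module.Finite R A]
    (h : ∀ a : A, ∃ b : A, x • b = a) : Subsingleton A := by
  have h1 : (⊤ : Submodule R A) ≤ maximalIdeal R • ⊤ := by
    intro a _
    obtain ⟨b, rfl⟩ := h a
    exact Submodule.smul_mem_smul hx trivial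
  have h2 := Submodule.eq_bot_of_le_smul_of_le_jacobson_bot (maximalIdeal R) ⊤
    (Module.Finite.fg_top) h1 (IsLocalRing.maximalIdeal_le_jacobson _)
  exact Submodule.subsingleton_iff R |>.1 (subsingleton_of_bot_eq_top h2.symm)

/-- The basic induction on dimension. -/
theorem dimInd (Q : ℕ → ∀ (N : Type) [AddCommGroup N] [Module R N], Prop)
    (hsub : ∀ i (N : Type) [AddCommGroup N] [Module R N], Subsingleton N → Q i N)
    (hex : ∀ i (N₁ : Type) [AddCommGroup N₁] [Module R N₁]
      (N₂ : Type) [AddCommGroup N₂] [Module R N₂]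
      (N₃ : Type) [AddCommGroup N₃] [Module R N₃] (f : N₁ →ₗ[R] N₂) (g : N₂ →ₗ[R] N₃),
      Module.Finite R N₁ → Module.Finite R N₂ → Module.Finite R N₃ → 
      Function.Injective f → Function.Surjective g → Function.Exact f g →
      Q i N₁ → Q i N₃ → Q i N₂)
    (hk : ∀ i (N : Type) [AddCommGroup N] [Module R N], (N ≃ₗ[R] R ⧸ maximalIdeal R) → Q (i+1) N)
    (hx : ∀ i (N : Type) [AddCommGroup N] [Module R N] (x : R), Module.Finite R N →
      x ∈ maximalIdeal R → IsSMulRegular N x → Q i (QuotSMulTop x N) → Q (i+1) N) :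
    ∀ i (N : Type) [AddCommGroup N] [Module R N] [Module.Finite R N], dlt R i N → Q i N := by
  intro i
  induction i with
  | zero => intro N _ _ _ h; exact hsub _ _ (dlt_zero.1 h)
  | succ i ih =>
    intro N _ _ fN
    induction fN using IsNoetherianRing.induction_on_isQuotientEquivQuotientPrime R with
    | subsingleton N => intro _; exact hsub _ _ inferInstance
    | exact N₁ N₂ N₃ f g hf hg hfg h₁ h₃ =>
      intro h
      exact hex _ N₁ N₂ N₃ f g inferInstance inferInstance inferInstance hf hg hfg
        (h₁ (dlt_inj f hf h)) (h₃ (dlt_surj g hg h))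
    | quotient N p e =>
      intro h
      by_cases hp : p.asIdeal = maximalIdeal R
      · rw [hp] at e
        exact hk _ _ e
      · have : ¬ maximalIdeal R ≤ p.asIdeal := fun h' =>
          hp (le_antisymm (IsLocalRing.le_maximalIdeal p.2.ne_top) h')
        obtain ⟨x, hxm, hxp⟩ := SetLike.not_le_iff_exists.1 this
        have hreg : IsSMulRegular N x := by
          intro a b hab
          have : x • (e (a - b)) = 0 := by
            rw [← map_smul, smul_sub, sub_eq_zero.2 hab, map_zero]
          obtain ⟨y, hy⟩ := Ideal.Quotient.mk_surjective (e (a - b))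
          rw [← hy] at this
          have h3 : Ideal.Quotient.mk p.asIdeal (x * y) = 0 := this
          rw [Ideal.Quotient.eq_zero_iff_mem] at h3
          have h4 := (p.2.mem_or_mem h3).resolve_left hxp
          rw [Ideal.Quotient.eq_zero_iff_mem.2 h4] at hy
          have := e.map_eq_zero_iff.1 hy.symm
          exact sub_eq_zero.1 this
        exact hx i N x inferInstance hxm hreg (ih _ (dlt_quot_of hxm hreg h))

end dims
end Pesk

namespace Pesk
section basic
open IsLocalRing Pointwise
variable {R : Type} [CommRing R]
variable {A B C : Type} [AddCommGroup A] [Module R A] [AddCommGroup B] [Module R B]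
  [AddCommGroup C] [Module R C]
variable (Y : Type) [AddCommGroup Y] [Module R Y]

/-- multiplication by `x` as a linear map -/
abbrev mx (x : R) (A : Type) [AddCommGroup A] [Module R A] : A →ₗ[R] A := x • LinearMap.id

/-- projection to `A / x A` -/
abbrev px (x : R) (A : Type) [AddCommGroup A] [Module R A] : A →ₗ[R] QuotSMulTop x A :=
  (x • (⊤ : Submodule R A)).mkQ

lemma mem_xtop {x : R} {a : A} : a ∈ x • (⊤ : Submodule R A) ↔ ∃ b, x • b = a := by
  rw [Submodule.mem_smul_pointwise_iff_exists]
  simp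

lemma mx_exact (x : R) : Function.Exact (mx x A) (px x A) := by
  intro a
  rw [Submodule.mkQ_apply, Submodule.Quotient.mk_eq_zero, mem_xtop]
  rfl

lemma mx_inj {x : R} (h : IsSMulRegular A x) : Function.Injective (mx x A) := fun _ _ e => h e

lemma px_surj (x : R) : Function.Surjective (px x A) := Submodule.mkQ_surjective _

lemma eMap_mx (x : R) (j : ℕ) (e : X R j A Y) : eMap Y j (mx x A) e = x • e := by
  rw [eMap_smul, eMap_id]

lemma cMap_mx (x : R) (j : ℕ) (e : X R j Y A) : cMap Y j (mx x A) e = x • e := by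
  rw [cMap_smul, cMap_id]

/-- connecting map for multiplication by `x` -/
noncomputable def dx {x : R} (hx : IsSMulRegular A x) (j : ℕ) :
    X R j A Y →ₗ[R] X R (j+1) (QuotSMulTop x A) Y :=
  dl Y (mx_exact x) (mx_inj hx) (px_surj x) j

lemma dx_zero {x : R} (hx : IsSMulRegular A x) (j : ℕ) (e : X R j A Y) :
    dx Y hx j e = 0 ↔ ∃ e', x • e' = e := by
  rw [dx, (ex1 Y (mx_exact x) (mx_inj hx) (px_surj x) j) e]
  simp [Set.mem_range, eMap_mx]

lemma dx_range {x : R} (hx : IsSMulRegular A x) (j : ℕ) :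
    Function.Exact (dx Y hx j) (eMap Y (j+1) (px x A)) :=
  ex3 Y (mx_exact x) (mx_inj hx) (px_surj x) j

lemma smul_zero_iff {x : R} (hx : IsSMulRegular A x) (j : ℕ) (e : X R j A Y) :
    x • e = 0 ↔ ∃ e', eMap Y j (px x A) e' = e := by
  rw [← eMap_mx, (ex2 Y (mx_exact x) (mx_inj hx) (px_surj x) j) e]
  simp [Set.mem_range]

lemma x_of_sub [Subsingleton A] (j : ℕ) : Subsingleton (X R j A Y) := by
  refine ⟨fun a b => ?_⟩
  have h : (LinearMap.id : A →ₗ[R] A) = 0 := LinearMap.ext fun _ => Subsingleton.elim _ _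
  rw [← eMap_id Y j a, ← eMap_id Y j b, h, eMap_zero, eMap_zero]

lemma sub_equiv {j : ℕ} (e : A ≃ₗ[R] B) (h : Subsingleton (X R j B Y)) :
    Subsingleton (X R j A Y) := (eEquiv Y j e).symm.toEquiv.subsingleton

lemma sub_mid {f : A →ₗ[R] B} {g : B →ₗ[R] C} (h : Function.Exact f g)
    (h1 : Subsingleton A) (h2 : Subsingleton C) : Subsingleton B := by
  refine subsingleton_of_forall_eq 0 fun b => ?_
  obtain ⟨a, rfl⟩ := (h b).1 (Subsingleton.elim _ _)
  rw [Subsingleton.elim a 0, map_zero]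

lemma sub_of_inj {f : A →ₗ[R] B} (h : Function.Injective f) (h1 : Subsingleton B) :
    Subsingleton A := h.subsingleton

variable [IsNoetherianRing R] [IsLocalRing R]

/-- If `Ext^{j+1}(A/x,Y)=0` then `Ext^j(A,Y)=0`. -/
lemma sub_of_quot [Module.Finite R A] [Module.Finite R Y] {x : R} (hx : x ∈ maximalIdeal R)
    (hreg : IsSMulRegular A x) (j : ℕ) (h : Subsingleton (X R (j+1) (QuotSMulTop x A) Y)) :
    Subsingleton (X R j A Y) :=
  nak hx fun e => (dx_zero Y hreg j e).1 (Subsingleton.elim _ _)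

theorem L1 [Module.Finite R Y] (D : ℕ)
    (hY : ∀ j, D < j → Subsingleton (X R j (R ⧸ maximalIdeal R) Y)) (i : ℕ)
    (N : Type) [AddCommGroup N] [Module R N] [Module.Finite R N] (hN : dlt R i N) (j : ℕ)
    (hj : D < j) : Subsingleton (X R j N Y) := by
  refine dimInd (R := R) (fun i N _ _ => ∀ j, D < j → Subsingleton (X R j N Y)) ?_ ?_ ?_ ?_ i N hN j hj
  · intro i N _ _ _ j _; exact x_of_sub Y j
  · intro i N₁ _ _ N₂ _ _ N₃ _ _ f g _ _ _ hf hg hfg h1 h3 j hj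
    exact sub_mid (ex2 Y hfg hf hg j) (h3 j hj) (h1 j hj)
  · intro i N _ _ e j hj
    exact sub_equiv Y e (hY j hj)
  · intro i N _ _ x _ hx hreg h j hj
    exact sub_of_quot Y hx hreg j (h (j+1) (by lia))

theorem L2 [Module.Finite R Y] (D : ℕ)
    (hY : ∀ j, j < D → Subsingleton (X R j (R ⧸ maximalIdeal R) Y)) (i : ℕ)
    (N : Type) [AddCommGroup N] [Module R N] [Module.Finite R N] (hN : dlt R i N) (j : ℕ)
    (hj : j + i ≤ D) : Subsingleton (X R j N Y) := by
  refine dimInd (R := R) (fun i N _ _ => ∀ j, j + i ≤ D → Subsingleton (X R j N Y)) ?_ ?_ ?_ ?_ i N hN j hj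
  · intro i N _ _ _ j _; exact x_of_sub Y j
  · intro i N₁ _ _ N₂ _ _ N₃ _ _ f g _ _ _ hf hg hfg h1 h3 j hj
    exact sub_mid (ex2 Y hfg hf hg j) (h3 j hj) (h1 j hj)
  · intro i N _ _ e j hj
    exact sub_equiv Y e (hY j (by lia))
  · intro i N _ _ x _ hx hreg h j hj
    exact sub_of_quot Y hx hreg j (h (j+1) (by lia))

/-- E/xE embeds in Ext^{j+1}(A/x) -/
lemma quot_inj {x : R} (hreg : IsSMulRegular A x) (j : ℕ) :
    ∃ f : QuotSMulTop x (X R j A Y) →ₗ[R] X R (j+1) (QuotSMulTop x A) Y, Function.Injective f ∧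
      LinearMap.range f = LinearMap.range (dx Y hreg j) := by
  have hk : LinearMap.ker (dx Y hreg j) = x • (⊤ : Submodule R (X R j A Y)) := by
    ext e
    rw [LinearMap.mem_ker, dx_zero, mem_xtop]
  refine ⟨Submodule.liftQ _ (dx Y hreg j) hk.ge, ?_, ?_⟩
  · exact LinearMap.ker_eq_bot.1 (Submodule.ker_liftQ_eq_bot _ _ _ hk.le)
  · rw [Submodule.range_liftQ]

theorem L3 [Module.Finite R Y] (D : ℕ)
    (hY : ∀ j, D < j → Subsingleton (X R j (R ⧸ maximalIdeal R) Y)) (d : ℕ)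
    (N : Type) [AddCommGroup N] [Module R N] [Module.Finite R N] (hN : dlt R d N) (i j : ℕ)
    (hj : i + j = D) : dlt R (i+1) (X R j N Y) := by
  refine (dimInd (R := R) (fun d N _ _ => Module.Finite R N → dlt R d N → ∀ i j, i + j = D →
    dlt R (i+1) (X R j N Y)) ?_ ?_ ?_ ?_ d N hN) inferInstance hN i j hj
  · intro d N _ _ _ _ _ i j _
    have := x_of_sub (R := R) (A := N) Y j
    exact dlt_sub _
  · intro d N₁ _ _ N₂ _ _ N₃ _ _ f g _ _ _ hf hg hfg h1 h3 _ hd i j hj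
    exact dlt_exact (ex2 Y hfg hf hg j) (h3 inferInstance (dlt_surj g hg hd) i j hj)
      (h1 inferInstance (dlt_inj f hf hd) i j hj)
  · intro d N _ _ e _ _ i j _
    refine dlt_mono (i := 1) (by lia) (dlt_killed ?_)
    intro r hr a
    rw [← eMap_mx]
    have : mx r N = 0 := by
      ext a
      apply e.injective
      obtain ⟨y, hy⟩ := Ideal.Quotient.mk_surjective (e a)
      have h2 : e (mx r N a) = r • e a := map_smul e r a
      rw [h2, ← hy]
      have : r • Ideal.Quotient.mk (maximalIdeal R) y = Ideal.Quotient.mk (maximalIdeal R) (r * y) := rfl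
      rw [this, LinearMap.zero_apply, map_zero, Ideal.Quotient.eq_zero_iff_mem]
      exact Ideal.mul_mem_right _ _ hr
    rw [this, eMap_zero]
  · intro d N _ _ x _ hx hreg h _ hd i j hj
    have hd' := dlt_quot_of hx hreg hd
    obtain ⟨f, hf, -⟩ := quot_inj Y hreg j
    refine dlt_of_quot hx (dlt_inj f hf ?_)
    cases i with
    | zero =>
      have := L1 Y D hY _ _ hd' (j+1) (by lia)
      exact dlt_sub _
    | succ i => exact h inferInstance hd' i (j+1) (by lia)

end basic
end Pesk

namespace Pesk
section can
open IsLocalRing Pointwise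
variable {R : Type} [CommRing R]
variable {A B C : Type} [AddCommGroup A] [Module R A] [AddCommGroup B] [Module R B]
  [AddCommGroup C] [Module R C]

lemma killed_x (Y : Type) [AddCommGroup Y] [Module R Y] {r : R} (h : ∀ a : A, r • a = 0) (j : ℕ)
    (e : X R j A Y) : r • e = 0 := by
  rw [← eMap_mx]
  have : mx r A = 0 := by ext a; exact h a
  rw [this, eMap_zero]

variable [IsNoetherianRing R] [IsLocalRing R]

/-- The properties of the canonical module which are used. -/
structure Can (R : Type) [CommRing R] [IsNoetherianRing R] [IsLocalRing R]
    (n : ℕ) (ω : Type) [AddCommGroup ω] [Module R ω] : Prop where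
  fin : Module.Finite R ω
  dim : ringKrullDim R = (n : WithBot ℕ∞)
  van : ∀ j, j ≠ n → Subsingleton (X R j (R ⧸ maximalIdeal R) ω)
  nz : Nontrivial (X R n (R ⧸ maximalIdeal R) ω)

/-- `Ext^j(M,ω)=0` for `j > n - t` (i.e. depth at least `t`) -/
def dge (R : Type) [CommRing R] (n : ℕ) (ω : Type) [AddCommGroup ω] [Module R ω] (t : ℕ)
    (M : Type) [AddCommGroup M] [Module R M] : Prop :=
  ∀ j, n < j + t → Subsingleton (X R j M ω)

/-- zero or Cohen-Macaulay of dimension `t` -/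
def CMz (R : Type) [CommRing R] (n : ℕ) (ω : Type) [AddCommGroup ω] [Module R ω] (t : ℕ)
    (M : Type) [AddCommGroup M] [Module R M] : Prop :=
  dlt R (t+1) M ∧ dge R n ω t M

/-- no socle -/
def sf (R : Type) [CommRing R] [IsLocalRing R] (M : Type) [AddCommGroup M] [Module R M] : Prop :=
  ∀ u : M, (∀ r ∈ maximalIdeal R, r • u = 0) → u = 0

variable {n : ℕ} {ω : Type} [AddCommGroup ω] [Module R ω]

lemma dge_equiv {t : ℕ} (e : A ≃ₗ[R] B) (h : dge R n ω t B) : dge R n ω t A :=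
  fun j hj => sub_equiv ω e (h j hj)

lemma CMz_equiv {t : ℕ} (e : A ≃ₗ[R] B) (h : CMz R n ω t B) : CMz R n ω t A :=
  ⟨dlt_equiv e.symm h.1, dge_equiv e h.2⟩

lemma CMz_sub (h : Subsingleton A) (t : ℕ) : CMz R n ω t A :=
  ⟨dlt_sub _, fun j _ => x_of_sub ω j⟩

lemma dge_mono {s t : ℕ} (hst : s ≤ t) (h : dge R n ω t A) : dge R n ω s A :=
  fun j hj => h j (by lia)

lemma dge_mid {t : ℕ} {f : A →ₗ[R] B} {g : B →ₗ[R] C} (h : Function.Exact f g)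
    (hf : Function.Injective f) (hg : Function.Surjective g)
    (hA : dge R n ω t A) (hC : dge R n ω t C) : dge R n ω t B :=
  fun j hj => sub_mid (ex2 ω h hf hg j) (hC j hj) (hA j hj)

lemma dge_left {t : ℕ} {f : A →ₗ[R] B} {g : B →ₗ[R] C} (h : Function.Exact f g)
    (hf : Function.Injective f) (hg : Function.Surjective g)
    (hB : dge R n ω t B) (hC : dge R n ω (t-1) C) : dge R n ω t A :=
  fun j hj => sub_mid (ex1 ω h hf hg j) (hB j hj) (hC (j+1) (by lia))

lemma exists_reg [Module.Finite R A] (h : sf R A) : ∃ x ∈ maximalIdeal R, IsSMulRegular A x := by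
  by_contra! hh
  have hexist : ∃ p ∈ associatedPrimes R A, maximalIdeal R ≤ p := by
    apply (Ideal.subset_union_prime_finite (associatedPrimes.finite R A) ⊥ ⊥ _).mp
    · rw [biUnion_associatedPrimes_eq_compl_regular R A]
      exact fun r hr ↦ hh r hr
    · exact fun I hin _ _ ↦ IsAssociatedPrime.isPrime hin
  obtain ⟨p, hp, hmp⟩ := hexist
  obtain ⟨hpr, u, hu⟩ := isAssociatedPrime_iff.1 hp
  have hu0 : u = 0 := by
    apply h
    intro r hr
    have := hmp hr
    rw [hu] at this
    simpa [Submodule.mem_colon_singleton] using this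
  apply hpr.ne_top
  rw [hu, hu0]
  ext r
  simp [Submodule.mem_colon_singleton]

lemma socle_inj {u : A} (hne : u ≠ 0) (hu : ∀ r ∈ maximalIdeal R, r • u = 0) :
    ∃ f : (R ⧸ maximalIdeal R) →ₗ[R] A, Function.Injective f := by
  have hle : maximalIdeal R ≤ LinearMap.ker (LinearMap.toSpanSingleton R A u) := by
    intro r hr
    simpa using hu r hr
  have hker : LinearMap.ker (LinearMap.toSpanSingleton R A u) ≤ maximalIdeal R := by
    apply IsLocalRing.le_maximalIdeal
    intro h
    apply hne
    have : (1 : R) ∈ LinearMap.ker (LinearMap.toSpanSingleton R A u) := by rw [h]; trivial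
    simpa using this
  exact ⟨Submodule.liftQ _ _ hle, LinearMap.ker_eq_bot.1 (Submodule.ker_liftQ_eq_bot _ _ _ hker)⟩

lemma sf_prod (hA : sf R A) (hB : sf R B) : sf R (A × B) := by
  intro u hu
  refine Prod.ext (hA _ fun r hr => ?_) (hB _ fun r hr => ?_)
  · exact congrArg Prod.fst (hu r hr)
  · exact congrArg Prod.snd (hu r hr)

lemma exists_reg2 [Module.Finite R A] [Module.Finite R B] (hA : sf R A) (hB : sf R B) :
    ∃ x ∈ maximalIdeal R, IsSMulRegular A x ∧ IsSMulRegular B x := by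
  obtain ⟨x, hx, hr⟩ := exists_reg (sf_prod hA hB)
  refine ⟨x, hx, fun a b hab => ?_, fun a b hab => ?_⟩
  · have := @hr (a, 0) (b, 0) (Prod.ext hab rfl)
    exact congrArg Prod.fst this
  · have := @hr (0, a) (0, b) (Prod.ext rfl hab)
    exact congrArg Prod.snd this

section withH
variable (H : Can R n ω)
include H

lemma dlt_n [Module.Finite R A] : dlt R (n+1) A := by
  rw [dlt_succ, ← H.dim]
  exact Module.supportDim_le_ringKrullDim R A

lemma vanish [Module.Finite R A] (j : ℕ) (hj : n < j) : Subsingleton (X R j A ω) := by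
  have := H.fin
  exact L1 ω n (fun j hj => H.van j (by lia)) _ A (dlt_n H) j hj

lemma dge_zero [Module.Finite R A] : dge R n ω 0 A := fun j hj => vanish H j hj

lemma D1 [Module.Finite R A] {x : R} (hx : x ∈ maximalIdeal R) (hreg : IsSMulRegular A x) {t : ℕ} :
    dge R n ω (t+1) A ↔ dge R n ω t (QuotSMulTop x A) := by
  have := H.fin
  constructor
  · intro h j hj
    cases j with
    | zero => exact sub_of_inj (ex0 ω (px_surj x)) (h 0 (by lia))
    | succ j =>
      exact sub_mid (dx_range ω hreg j) (h j (by lia)) (h (j+1) (by lia))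
  · intro h j hj
    exact sub_of_quot ω hx hreg j (h (j+1) (by lia))

lemma sf_of_dge [Module.Finite R A] (h : dge R n ω 1 A) : sf R A := by
  intro u hu
  by_contra hne
  obtain ⟨f, hf⟩ := socle_inj hne hu
  have h1 := ex1 ω (LinearMap.exact_map_mkQ_range f) hf (Submodule.mkQ_surjective _) n
  have h2 : Subsingleton (X R n (R ⧸ maximalIdeal R) ω) :=
    sub_mid h1 (h n (by lia)) (vanish H (n+1) (by lia))
  exact not_nontrivial_iff_subsingleton.2 h2 H.nz

theorem D3 (t : ℕ) : ∀ (M : Type) [AddCommGroup M] [Module R M] [Module.Finite R M],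
    dge R n ω t M ↔ ∀ j < t, Subsingleton (X R j (R ⧸ maximalIdeal R) M) := by
  induction t with
  | zero => intro M _ _ _; simp [dge_zero H]
  | succ t ih =>
    intro M _ _ _
    constructor
    · intro h
      obtain ⟨x, hx, hreg⟩ := exists_reg (sf_of_dge H (dge_mono (by lia) h))
      have h1 := (ih _).1 ((D1 H hx hreg).1 h)
      have hk : ∀ j (e : X R j (R ⧸ maximalIdeal R) M), cMap _ j (mx x M) e = 0 := by
        intro j e
        rw [cMap_mx]
        refine killed_x M ?_ j e
        intro a
        obtain ⟨b, rfl⟩ := Submodule.mkQ_surjective _ a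
        rw [← map_smul, Submodule.mkQ_apply, Submodule.Quotient.mk_eq_zero, smul_eq_mul]
        exact Ideal.mul_mem_right _ _ hx
      intro j hj
      refine subsingleton_of_forall_eq 0 fun e => ?_
      cases j with
      | zero =>
        refine cex0 _ (mx_inj hreg) ?_
        rw [hk, map_zero]
      | succ j =>
        obtain ⟨e', rfl⟩ := ((cex1 (R ⧸ maximalIdeal R) (mx_exact x) (mx_inj hreg) (px_surj x) j) e).1 (hk _ e)
        have := h1 j (by lia)
        rw [Subsingleton.elim e' 0, map_zero]
    · intro h
      have hsf : sf R M := by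
        intro u hu
        by_contra hne
        obtain ⟨f, hf⟩ := socle_inj hne hu
        have := h 0 (by lia)
        have h0 : Subsingleton ((R ⧸ maximalIdeal R) →ₗ[R] M) := (x0 M).symm.toEquiv.subsingleton
        have hf0 : f = 0 := Subsingleton.elim _ _
        rw [hf0] at hf
        have h1 : (1 : R ⧸ maximalIdeal R) = 0 := hf (by simp)
        exact one_ne_zero h1
      obtain ⟨x, hx, hreg⟩ := exists_reg hsf
      rw [D1 H hx hreg, ih]
      intro j hj
      exact sub_mid (cex3 (R ⧸ maximalIdeal R) (mx_exact x) (mx_inj hreg) (px_surj x) j) (h j (by lia))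
        (h (j+1) (by lia))

/-- No nonzero map from a module of small dimension to one of big depth. -/
theorem D4 [Module.Finite R A] [Module.Finite R B] {t : ℕ} (hB : dge R n ω t B)
    (hA : dlt R t A) (f : A →ₗ[R] B) : f = 0 := by
  have h := L2 B t ((D3 H t B).1 hB) t A hA 0 (by lia)
  have h0 : Subsingleton (A →ₗ[R] B) := (x0 B).symm.toEquiv.subsingleton
  exact Subsingleton.elim _ _

lemma F1 [Module.Finite R A] {t : ℕ} (h : dge R n ω t A) (h' : dlt R t A) : Subsingleton A := by
  have := D4 H h h' LinearMap.id
  exact subsingleton_of_forall_eq 0 fun a => LinearMap.congr_fun this a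

lemma F3 [Module.Finite R A] {t : ℕ} {x : R} (hx : x ∈ maximalIdeal R) (hreg : IsSMulRegular A x) :
    CMz R n ω (t+1) A ↔ CMz R n ω t (QuotSMulTop x A) :=
  ⟨fun h => ⟨dlt_quot_of hx hreg h.1, (D1 H hx hreg).1 h.2⟩,
   fun h => ⟨dlt_of_quot hx h.1, (D1 H hx hreg).2 h.2⟩⟩

lemma F4' [Module.Finite R A] {t j : ℕ} (h : dlt R t A) (hj : j + t ≤ n) :
    Subsingleton (X R j A ω) := by
  have := H.fin
  exact L2 ω n (fun j hj => H.van j (by lia)) t A h j hj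

lemma F4 [Module.Finite R A] {t j : ℕ} (h : CMz R n ω t A) (hj : j + t ≠ n) :
    Subsingleton (X R j A ω) := by
  rcases lt_or_gt_of_ne hj with h' | h'
  · exact F4' H h.1 (by lia)
  · exact h.2 j h'

lemma F6 [Module.Finite R A] {i j : ℕ} (h : i + j = n) : dlt R (i+1) (X R j A ω) := by
  have := H.fin
  exact L3 ω n (fun j hj => H.van j (by lia)) (n+1) A (dlt_n H) i j h

theorem F5 (t : ℕ) : ∀ (M : Type) [AddCommGroup M] [Module R M] [Module.Finite R M] (j : ℕ),
    CMz R n ω t M → j + t = n → CMz R n ω t (X R j M ω) := by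
  have := H.fin
  induction t with
  | zero => 
    intro M _ _ _ j h hj
    exact ⟨F6 H (by lia), dge_zero H⟩
  | succ t ih =>
    intro M _ _ _ j h hj
    obtain ⟨x, hx, hreg⟩ := exists_reg (sf_of_dge H (dge_mono (by lia) h.2))
    have hq := (F3 H hx hreg).1 h
    have h1 := ih _ (j+1) hq (by lia)
    have hregE : IsSMulRegular (X R j M ω) x := by
      have hs := F4 H (j := j) hq (by lia)
      intro a b hab
      have h0 : x • (a - b) = 0 := by rw [smul_sub, sub_eq_zero]; exact hab
      obtain ⟨e', he⟩ := (smul_zero_iff ω hreg j _).1 h0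
      rw [Subsingleton.elim e' 0, map_zero] at he
      exact sub_eq_zero.1 he.symm
    refine (F3 H hx hregE).2 ?_
    obtain ⟨f, hf, hr⟩ := quot_inj ω hreg j
    have hs := h.2 (j+1) (by lia)
    refine CMz_equiv (LinearEquiv.ofBijective f ⟨hf, ?_⟩) h1
    intro e
    have : e ∈ LinearMap.range (dx ω hreg j) := ((dx_range ω hreg j) e).1 (Subsingleton.elim _ _)
    rw [← hr] at this
    exact this

end withH
end can
end Pesk

namespace Pesk
section F7s
open IsLocalRing Pointwise
variable {R : Type} [CommRing R] [IsNoetherianRing R] [IsLocalRing R]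
variable {A B C : Type} [AddCommGroup A] [Module R A] [AddCommGroup B] [Module R B]
  [AddCommGroup C] [Module R C]
variable {n : ℕ} {ω : Type} [AddCommGroup ω] [Module R ω]

/-- Krull intersection for powers of an element. -/
lemma krull [Module.Finite R A] {x : R} (hx : x ∈ maximalIdeal R) (a : A)
    (h : ∀ k : ℕ, ∃ b : A, x ^ (k+1) • b = a) : a = 0 := by
  have h0 := Ideal.iInf_pow_smul_eq_bot_of_isLocalRing (M := A) (maximalIdeal R)
    (IsLocalRing.maximalIdeal.isMaximal R).ne_top
  have : a ∈ (⊥ : Submodule R A) := by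
    rw [← h0, Submodule.mem_iInf]
    intro k
    obtain ⟨b, rfl⟩ := h k
    rw [pow_succ, mul_smul]
    exact Submodule.smul_mem_smul (Ideal.pow_mem_pow hx k) trivial
  simpa using this

lemma F7zero (H : Can R n ω) [Module.Finite R A] (h : CMz R n ω 0 A) (y : R)
    (hy : ∀ e : X R n A ω, y • e = 0) (a : A) : y • a = 0 := by
  have := H.fin
  let q := (mx y A).rangeRestrict
  let i := (LinearMap.range (mx y A)).subtype
  have hiq : i ∘ₗ q = mx y A := by ext a; rfl
  have hsurj : ∀ e : X R n (LinearMap.range (mx y A)) ω, ∃ e', eMap ω n i e' = e := by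
    intro e
    have h1 := ex1 ω (LinearMap.exact_subtype_mkQ (LinearMap.range (mx y A)))
      (Submodule.injective_subtype _) (Submodule.mkQ_surjective _) n
    have := vanish H (A := A ⧸ LinearMap.range (mx y A)) (n+1) (by lia)
    exact (h1 e).1 (Subsingleton.elim _ _)
  have hq : Function.Surjective q := LinearMap.surjective_rangeRestrict _
  have hinj : ∀ e, eMap ω n q e = 0 → e = 0 := by
    intro e he
    rcases Nat.eq_zero_or_pos n with h0 | h0
    · subst h0
      exact ex0 ω hq (by rw [he, map_zero])
    · obtain ⟨m, rfl⟩ := Nat.exists_eq_succ_of_ne_zero h0.ne'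
      obtain ⟨e', rfl⟩ := (ex3 ω (LinearMap.exact_subtype_ker_map q) (Submodule.injective_subtype _) hq m e).1 he
      have : Subsingleton (X R m (LinearMap.ker q) ω) :=
        F4' H (dlt_inj _ (Submodule.injective_subtype _) h.1) (by lia)
      rw [Subsingleton.elim e' 0, map_zero]
  have hs : Subsingleton (X R n (LinearMap.range (mx y A)) ω) := by
    refine subsingleton_of_forall_eq 0 fun e => ?_
    obtain ⟨e', rfl⟩ := hsurj e
    apply hinj
    rw [← eMap_comp, hiq, eMap_mx, hy]
  have hd : dge R n ω 1 (LinearMap.range (mx y A)) := by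
    intro j hj
    rcases eq_or_ne j n with rfl | hne
    · exact hs
    · exact vanish H j (by lia)
  have := F1 H hd (dlt_inj _ (Submodule.injective_subtype _) h.1)
  have h2 : (mx y A).rangeRestrict a = 0 := Subsingleton.elim _ _
  exact congrArg Subtype.val h2

theorem F7 (H : Can R n ω) (t : ℕ) : ∀ (M : Type) [AddCommGroup M] [Module R M] [Module.Finite R M] (j : ℕ),
    CMz R n ω t M → j + t = n → ∀ y : R, (∀ e : X R j M ω, y • e = 0) → ∀ a : M, y • a = 0 := by
  have := H.fin
  induction t with
  | zero =>
    intro M _ _ _ j h hj y hy a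
    obtain rfl : j = n := hj
    exact F7zero H h y hy a
  | succ t ih =>
    intro M _ _ _ j h hj y hy a
    obtain ⟨x, hx, hreg⟩ := exists_reg (sf_of_dge H (dge_mono (by lia) h.2))
    refine krull hx _ fun k => ?_
    have hxk : x ^ (k+1) ∈ maximalIdeal R := Ideal.pow_mem_of_mem _ hx _ (by lia)
    have hrk : IsSMulRegular M (x^(k+1)) := hreg.pow (k+1)
    have h1 := ih _ (j+1) ((F3 H hxk hrk).1 h) (by lia) y (by
      intro e
      have hs := h.2 (j+1) (by lia)
      obtain ⟨e', rfl⟩ := ((dx_range ω hrk j) e).1 (Subsingleton.elim _ _)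
      rw [← map_smul, hy, map_zero]) (px _ M a)
    rw [← map_smul, Submodule.mkQ_apply, Submodule.Quotient.mk_eq_zero, mem_xtop] at h1
    exact h1

lemma dge_iff_depth (H : Can R n ω) [Module.Finite R A] (t : ℕ) :
    dge R n ω t A ↔ (t : ℕ∞) ≤ mDepth R (maximalIdeal R) A := by
  rw [D3 H, mDepth, le_sInf_iff]
  constructor
  · rintro h _ ⟨j, rfl, hj⟩
    by_contra hlt
    have hjt : j < t := by exact_mod_cast not_le.1 hlt
    obtain ⟨e⟩ := bridge R j (R ⧸ maximalIdeal R) A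
    have := h j hjt
    have h2 : Subsingleton (extC R j (R ⧸ maximalIdeal R) A) := e.toEquiv.subsingleton
    exact not_nontrivial_iff_subsingleton.2 h2 hj
  · intro h j hj
    by_contra hs
    obtain ⟨e⟩ := bridge R j (R ⧸ maximalIdeal R) A
    have hnt := not_subsingleton_iff_nontrivial.1 hs
    have := h j ⟨j, rfl, e.toEquiv.nontrivial⟩
    have : t ≤ j := by exact_mod_cast this
    lia

lemma F2 (H : Can R n ω) [Module.Finite R A] (i : ℕ) :
    (IsCM R (maximalIdeal R) A ∧ mDim R A = (i : WithBot ℕ∞)) ↔ Nontrivial A ∧ CMz R n ω i A := by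
  have hm : mDim R A = Module.supportDim R A := rfl
  constructor
  · rintro ⟨⟨h1, h2⟩, h3⟩
    refine ⟨h1, dlt_succ.2 (hm ▸ h3.le), ?_⟩
    rw [dge_iff_depth H]
    rw [h3] at h2
    have : mDepth R (maximalIdeal R) A = (i : ℕ∞) := by exact_mod_cast h2
    rw [this]
  · rintro ⟨h1, h2, h3⟩
    have hns : ¬ Subsingleton A := not_subsingleton_iff_nontrivial.2 h1
    have hd : mDim R A = (i : WithBot ℕ∞) := by
      refine le_antisymm (dlt_succ.1 h2) (not_lt.1 fun h => hns (F1 H h3 h))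
    refine ⟨⟨h1, ?_⟩, hd⟩
    rw [hd]
    have : mDepth R (maximalIdeal R) A = (i : ℕ∞) := by
      refine le_antisymm ?_ ((dge_iff_depth H i).1 h3)
      by_contra hlt
      apply hns
      refine F1 H ((dge_iff_depth H (i+1)).2 ?_) h2
      exact_mod_cast Order.add_one_le_of_lt (not_le.1 hlt)
    rw [this]; rfl

end F7s
end Pesk

namespace Pesk
section mainL
open IsLocalRing Pointwise
variable {R : Type} [CommRing R] [IsNoetherianRing R] [IsLocalRing R]
variable {M : Type} [AddCommGroup M] [Module R M]
variable {n : ℕ} {ω : Type} [AddCommGroup ω] [Module R ω]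

lemma comap_seq (S : Submodule R M) (Q : Submodule R (M ⧸ S)) :
    ∃ (f : S →ₗ[R] Q.comap S.mkQ) (g : Q.comap S.mkQ →ₗ[R] Q),
      Function.Injective f ∧ Function.Surjective g ∧ Function.Exact f g := by
  have hle : S ≤ Q.comap S.mkQ := by
    intro u hu
    rw [Submodule.mem_comap, Submodule.mkQ_apply, (Submodule.Quotient.mk_eq_zero S).2 hu]
    exact Q.zero_mem
  refine ⟨Submodule.inclusion hle, S.mkQ.restrict (fun u hu => hu), Submodule.inclusion_injective hle,
    ?_, ?_⟩
  · rintro ⟨q, hq⟩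
    obtain ⟨u, rfl⟩ := S.mkQ_surjective q
    exact ⟨⟨u, hq⟩, rfl⟩
  · rintro ⟨u, hu⟩
    rw [Subtype.ext_iff]
    constructor
    · intro h
      exact ⟨⟨u, (Submodule.Quotient.mk_eq_zero S).1 h⟩, rfl⟩
    · rintro ⟨v, hv⟩
      have : (v : M) = u := congrArg Subtype.val hv
      exact (Submodule.Quotient.mk_eq_zero S).2 (this ▸ v.2)

lemma dge_one (H : Can R n ω) [Module.Finite R M] (h : sf R M) : dge R n ω 1 M := by
  obtain ⟨x, hx, hreg⟩ := exists_reg h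
  exact (D1 H hx hreg).2 (dge_zero H)

lemma L_zero (H : Can R n ω) [Module.Finite R M] :
    ∃ T : Submodule R M, CMz R n ω 0 T ∧ dge R n ω 1 (M ⧸ T) := by
  obtain ⟨T, hT, hmax⟩ := set_has_maximal_iff_noetherian.2 (inferInstanceAs (IsNoetherian R M))
    {T : Submodule R M | dlt R 1 T} ⟨⊥, dlt_sub _⟩
  refine ⟨T, ⟨hT, dge_zero H⟩, dge_one H ?_⟩
  intro u hu
  by_contra hne
  obtain ⟨f, g, hf, hg, hfg⟩ := comap_seq T (Submodule.span R {u})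
  refine hmax _ (dlt_exact hfg hT (dlt_killed ?_)) ?_
  · rintro r hr ⟨a, ha⟩
    obtain ⟨b, rfl⟩ := Submodule.mem_span_singleton.1 ha
    apply Subtype.ext
    change r • b • u = 0
    rw [smul_comm, hu r hr, smul_zero]
  · refine lt_of_le_of_ne ?_ ?_
    · intro v hv
      rw [Submodule.mem_comap, Submodule.mkQ_apply, (Submodule.Quotient.mk_eq_zero T).2 hv]
      exact Submodule.zero_mem _
    · intro heq
      obtain ⟨v, rfl⟩ := T.mkQ_surjective u
      apply hne
      refine (Submodule.Quotient.mk_eq_zero T).2 ?_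
      rw [heq]
      exact Submodule.mem_span_singleton_self _

/-- Artin-Rees -/
lemma AR {W : Type} [AddCommGroup W] [Module R W] [Module.Finite R W] (φ : M →ₗ[R] W) (x : R) :
    ∃ k : ℕ, ∀ s, (∃ w, x ^ (k+1) • w = φ s) → ∃ v, φ (s - x • v) = 0 := by
  obtain ⟨k, hk⟩ := Ideal.exists_pow_inf_eq_pow_smul (Ideal.span {x}) (LinearMap.range φ)
  refine ⟨k, ?_⟩
  rintro s ⟨w, hw⟩
  have h1 : φ s ∈ Ideal.span {x} ^ (k+1) • (⊤ : Submodule R W) ⊓ LinearMap.range φ := by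
    refine ⟨?_, s, rfl⟩
    rw [← hw]
    exact Submodule.smul_mem_smul (Ideal.pow_mem_pow (Ideal.mem_span_singleton_self x) _) trivial
  rw [hk (k+1) (by lia)] at h1
  have h2 : φ s ∈ Ideal.span {x} • LinearMap.range φ := by
    have : k + 1 - k = 1 := by lia
    rw [this, pow_one] at h1
    exact Submodule.smul_mono le_rfl inf_le_right h1
  rw [Submodule.ideal_span_singleton_smul, Submodule.mem_smul_pointwise_iff_exists] at h2
  obtain ⟨_, ⟨v, rfl⟩, hv⟩ := h2
  exact ⟨v, by rw [map_sub, map_smul, hv, sub_self]⟩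

/-- The data of the approximations. -/
structure SD (n : ℕ) (ω : Type) [AddCommGroup ω] [Module R ω] (t j : ℕ) (x : R) (k : ℕ)
    (S : Submodule R M) : Prop where
  a : ∀ u, x ^ (k+1) • u ∈ S
  b : dge R n ω (t+1) (M ⧸ S)
  c : ∀ y : R, (∀ e : X R j M ω, y • e = 0) → ∀ u ∈ S, ∃ v, x ^ (k+1) • v = y • u
  d0 : dlt R (t+1) (S.map (px (x ^ (k+1)) M))
  d : ∀ (B : Type) [AddCommGroup B] [Module R B] [Module.Finite R B], dge R n ω (t+1) B →
    ∀ f : M →ₗ[R] B, (∀ u, f (x ^ (k+1) • u) = 0) → ∀ u ∈ S, f u = 0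
  e : ∀ (A : Type) [AddCommGroup A] [Module R A] [Module.Finite R A], dlt R (t+1) A →
    ∀ f : A →ₗ[R] QuotSMulTop (x ^ (k+1)) M, ∀ a u, px _ M u = f a → u ∈ S

lemma SD_exists (H : Can R n ω) [Module.Finite R M] (t j : ℕ) (hj : j + (t + 1) = n)
    (IH : ∀ (M : Type) [AddCommGroup M] [Module R M] [Module.Finite R M] (j : ℕ), j + t = n →
      dge R n ω t M → CMz R n ω t (X R j M ω) →
      ∃ T : Submodule R M, CMz R n ω t T ∧ dge R n ω (t+1) (M ⧸ T))
    (hM : dge R n ω (t+1) M) (hE : CMz R n ω (t+1) (X R j M ω)) (x : R)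
    (hx : x ∈ maximalIdeal R) (hreg : IsSMulRegular M x) (hregE : IsSMulRegular (X R j M ω) x)
    (k : ℕ) : ∃ S : Submodule R M, SD n ω t j x k S := by
  have := H.fin
  have hxk : x ^ (k+1) ∈ maximalIdeal R := Ideal.pow_mem_of_mem _ hx _ (by lia)
  have hrk : IsSMulRegular M (x^(k+1)) := hreg.pow (k+1)
  have hrkE : IsSMulRegular (X R j M ω) (x^(k+1)) := hregE.pow (k+1)
  have hs : ∀ e, ∃ e', dx ω hrk j e' = e := by
    intro e
    have := hM (j+1) (by lia)
    exact ((dx_range ω hrk j) e).1 (Subsingleton.elim _ _)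
  have hEk : CMz R n ω t (X R (j+1) (QuotSMulTop (x^(k+1)) M) ω) := by
    obtain ⟨f, hf, hr⟩ := quot_inj ω hrk j
    refine CMz_equiv (LinearEquiv.ofBijective f ⟨hf, ?_⟩).symm ((F3 H hxk hrkE).1 hE)
    intro e
    have : e ∈ LinearMap.range (dx ω hrk j) := hs e
    rw [← hr] at this
    exact this
  obtain ⟨T, hT, hT'⟩ := IH (QuotSMulTop (x^(k+1)) M) (j+1) (by lia) ((D1 H hxk hrk).1 hM) hEk
  have hmap : (T.comap (px (x^(k+1)) M)).map (px (x ^ (k+1)) M) = T :=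
    Submodule.map_comap_eq_of_surjective (px_surj _) T
  refine ⟨T.comap (px (x^(k+1)) M), ?_, ?_, ?_, ?_, ?_, ?_⟩
  · intro u
    rw [Submodule.mem_comap, Submodule.mkQ_apply, (Submodule.Quotient.mk_eq_zero _).2 (mem_xtop.2 ⟨u, rfl⟩)]
    exact T.zero_mem
  · have hker : LinearMap.ker (T.mkQ ∘ₗ px (x^(k+1)) M) = T.comap (px (x^(k+1)) M) := by
      rw [LinearMap.ker_comp, Submodule.ker_mkQ]
    rw [← hker]
    exact dge_equiv (LinearMap.quotKerEquivOfSurjective (T.mkQ ∘ₗ px (x^(k+1)) M)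
      (T.mkQ_surjective.comp (px_surj _))) hT'
  · intro y hy u hu
    have h1 := F7 H t T (j+1) hT (by lia) y (by
      intro e
      have := hT' (j+2) (by lia)
      obtain ⟨e', rfl⟩ := (ex1 ω (LinearMap.exact_subtype_mkQ T)
        (Submodule.injective_subtype _) (Submodule.mkQ_surjective _) (j+1) e).1 (Subsingleton.elim _ _)
      obtain ⟨e'', rfl⟩ := hs e'
      rw [← map_smul, ← map_smul, hy, map_zero, map_zero]) ⟨_, hu⟩
    have h2 := congrArg Subtype.val h1
    change y • px (x^(k+1)) M u = 0 at h2
    rw [← map_smul, Submodule.mkQ_apply, Submodule.Quotient.mk_eq_zero, mem_xtop] at h2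
    exact h2
  · rw [hmap]; exact hT.1
  · intro B _ _ _ hB f hf u hu
    let g : QuotSMulTop (x^(k+1)) M →ₗ[R] B := Submodule.liftQ _ f (by
      intro u hu
      obtain ⟨v, rfl⟩ := mem_xtop.1 hu
      exact hf v)
    have h1 := D4 H hB hT.1 (g ∘ₗ T.subtype)
    exact LinearMap.congr_fun h1 ⟨_, hu⟩
  · intro A _ _ _ hA f a u hau
    have h1 := D4 H hT' hA (T.mkQ ∘ₗ f)
    rw [Submodule.mem_comap, hau]
    exact (Submodule.Quotient.mk_eq_zero _).1 (LinearMap.congr_fun h1 a)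

variable {t j : ℕ} {x : R}

lemma SD_A1 [Module.Finite R M] {k : ℕ} {S S' : Submodule R M}
    (hS : SD n ω t j x k S) (hS' : SD n ω t j x (k+1) S') (u : M) (hu : u ∈ S) : x • u ∈ S' := by
  have h := hS.d _ hS'.b (S'.mkQ ∘ₗ mx x M) (by
    intro u
    refine (Submodule.Quotient.mk_eq_zero _).2 ?_
    change x • x ^ (k+1) • u ∈ S'
    rw [smul_smul, ← pow_succ']
    exact hS'.a u) u hu
  exact (Submodule.Quotient.mk_eq_zero _).1 h

lemma SD_A2 [Module.Finite R M] {k : ℕ} {S S' : Submodule R M} (hreg : IsSMulRegular M x)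
    (hS : SD n ω t j x k S) (hS' : SD n ω t j x (k+1) S') (u : M) (hu : x • u ∈ S') : u ∈ S := by
  have hle : x ^ (k+1) • (⊤ : Submodule R M) ≤ (x ^ (k+1+1) • (⊤ : Submodule R M)).comap (mx x M) := by
    intro v hv
    obtain ⟨w, rfl⟩ := mem_xtop.1 hv
    rw [Submodule.mem_comap, mem_xtop]
    refine ⟨w, ?_⟩
    change _ = x • x ^ (k+1) • w
    rw [smul_smul, ← pow_succ']
  let g : QuotSMulTop (x ^ (k+1)) M →ₗ[R] QuotSMulTop (x ^ (k+1+1)) M := Submodule.mapQ _ _ (mx x M) hle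
  have hg : Function.Injective g := by
    rw [injective_iff_map_eq_zero]
    intro a ha
    obtain ⟨v, rfl⟩ := px_surj _ a
    have h1 : x • v ∈ x ^ (k+1+1) • (⊤ : Submodule R M) := (Submodule.Quotient.mk_eq_zero _).1 ha
    obtain ⟨w, hw⟩ := mem_xtop.1 h1
    refine (Submodule.Quotient.mk_eq_zero _).2 (mem_xtop.2 ⟨w, ?_⟩)
    apply hreg
    change x • x ^ (k+1) • w = x • v
    rw [smul_smul, ← pow_succ', hw]
  let A := (S'.map (px (x ^ (k+1+1)) M)).comap g
  have hA : dlt R (t+1) A := by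
    refine dlt_inj (g.restrict (p := A) (q := S'.map (px (x ^ (k+1+1)) M)) (fun a ha => ha)) ?_ hS'.d0
    intro a b hab
    exact Subtype.ext (hg (congrArg Subtype.val hab))
  exact hS.e A hA A.subtype ⟨px _ M u, ⟨x • u, hu, rfl⟩⟩ u rfl

/-- Injectivity of `Ext(M/x) → Ext(M/x^{k+1})`. -/
lemma inj_tau (hM : Subsingleton (X R (j+1) M ω)) (hreg : IsSMulRegular M x)
    (hregE : IsSMulRegular (X R j M ω) x) (k : ℕ)
    (π : QuotSMulTop (x ^ (k+1)) M →ₗ[R] QuotSMulTop (x^(0+1)) M)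
    (hπ : π ∘ₗ px _ M = px _ M)
    (e : X R (j+1) (QuotSMulTop (x^(0+1)) M) ω) (he : eMap ω (j+1) π e = 0) : e = 0 := by
  have hrk : IsSMulRegular M (x^(k+1)) := hreg.pow (k+1)
  have hr0 : IsSMulRegular M (x^(0+1)) := hreg.pow (0+1)
  obtain ⟨e0, rfl⟩ := ((dx_range ω hr0 j) e).1 (Subsingleton.elim _ _)
  have h1 := dl_nat ω (mx_exact (A := M) (x^(k+1))) (mx_inj hrk) (px_surj _)
    (mx_exact (A := M) (x^(0+1))) (mx_inj hr0) (px_surj _) (mx (x^k) M) LinearMap.id π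
    (by ext u; change x^(0+1) • x^k • u = x^(k+1) • u; rw [smul_smul]; ring_nf)
    (by rw [hπ]; rfl) j e0
  rw [eMap_mx] at h1
  have h2 : dx ω hrk j (x^k • e0) = 0 := h1.symm.trans he
  rw [dx_zero] at h2
  obtain ⟨e', he'⟩ := h2
  rw [dx_zero]
  refine ⟨e', ?_⟩
  apply hregE.pow k
  change x ^ k • x ^ (0+1) • e' = x ^ k • e0
  rw [← he', smul_smul]; ring_nf

lemma SD_B (H : Can R n ω) [Module.Finite R M] (hj : j + (t + 1) = n)
    (hM : dge R n ω (t+1) M) (hreg : IsSMulRegular M x)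
    (hregE : IsSMulRegular (X R j M ω) x) {k : ℕ} {S S' : Submodule R M}
    (hS : SD n ω t j x k S) (hS' : SD n ω t j x (k+1) S') :
    dge R n ω (t+1) (M ⧸ (S' ⊔ x • (⊤ : Submodule R M))) := by
  intro l hl
  rcases eq_or_ne l (j+1) with rfl | hne
  · -- degree j+1
    have hle0 : x^(0+1) • (⊤ : Submodule R M) ≤ S' ⊔ x • (⊤ : Submodule R M) := by
      rw [zero_add, pow_one]; exact le_sup_right
    have hlek : x^(k+1+1) • (⊤ : Submodule R M) ≤ x^(0+1) • (⊤ : Submodule R M) := by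
      intro u hu
      obtain ⟨v, rfl⟩ := mem_xtop.1 hu
      exact mem_xtop.2 ⟨x^(k+1) • v, by rw [smul_smul]; ring_nf⟩
    have hleS : x^(k+1+1) • (⊤ : Submodule R M) ≤ S' := by
      intro u hu
      obtain ⟨v, rfl⟩ := mem_xtop.1 hu
      exact hS'.a v
    let q : QuotSMulTop (x^(0+1)) M →ₗ[R] M ⧸ (S' ⊔ x • (⊤ : Submodule R M)) := Submodule.factor hle0
    have hq : Function.Surjective q := Submodule.factor_surjective hle0
    let π : QuotSMulTop (x^(k+1+1)) M →ₗ[R] QuotSMulTop (x^(0+1)) M := Submodule.factor hlek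
    let p : QuotSMulTop (x^(k+1+1)) M →ₗ[R] M ⧸ S' := Submodule.factor hleS
    let p' : (M ⧸ S') →ₗ[R] M ⧸ (S' ⊔ x • (⊤ : Submodule R M)) := Submodule.factor le_sup_left
    have hcomm : q ∘ₗ π = p' ∘ₗ p := by
      ext u; rfl
    have hK : dlt R (t+1) (LinearMap.ker q) := by
      refine dlt_surj ((π ∘ₗ (S'.map (px (x^(k+1+1)) M)).subtype).codRestrict (LinearMap.ker q) ?_) ?_ hS'.d0
      · rintro ⟨_, u, hu, rfl⟩
        exact (Submodule.Quotient.mk_eq_zero _).2 (Submodule.mem_sup_left hu)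
      · rintro ⟨a, ha⟩
        obtain ⟨u, rfl⟩ := px_surj _ a
        have h1 : u ∈ S' ⊔ x • (⊤ : Submodule R M) := (Submodule.Quotient.mk_eq_zero _).1 ha
        obtain ⟨s, hs, w, hw, rfl⟩ := Submodule.mem_sup.1 h1
        refine ⟨⟨px _ M s, ⟨s, hs, rfl⟩⟩, Subtype.ext ?_⟩
        change (Submodule.Quotient.mk s : QuotSMulTop (x^(0+1)) M) = Submodule.Quotient.mk (s + w)
        rw [Submodule.Quotient.eq]
        have : s - (s + w) = - w := by abel
        rw [this]
        apply Submodule.neg_mem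
        rw [zero_add, pow_one]; exact hw
    refine subsingleton_of_forall_eq 0 fun e => ?_
    have hX := hS'.b (j+1) hl
    have h0 : eMap ω (j+1) q e = 0 := by
      refine inj_tau (hM (j+1) hl) hreg hregE (k+1) π (by ext u; rfl) _ ?_
      rw [← eMap_comp, hcomm, eMap_comp, Subsingleton.elim (eMap ω (j+1) p' e) 0, map_zero]
    obtain ⟨e', rfl⟩ := (ex3 ω (LinearMap.exact_subtype_ker_map q) (Submodule.injective_subtype _) hq j e).1 h0
    have : Subsingleton (X R j (LinearMap.ker q) ω) := F4' H hK (by lia)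
    rw [Subsingleton.elim e' 0, map_zero]
  · obtain ⟨l, rfl⟩ : ∃ m, l = m + 1 := ⟨l - 1, by lia⟩
    have hle : S ≤ S'.comap (mx x M) := fun u hu => SD_A1 hS hS' u hu
    let g : (M ⧸ S) →ₗ[R] M ⧸ S' := Submodule.mapQ _ _ (mx x M) hle
    have hg : Function.Injective g := by
      rw [injective_iff_map_eq_zero]
      intro a ha
      obtain ⟨v, rfl⟩ := S.mkQ_surjective a
      exact (Submodule.Quotient.mk_eq_zero _).2
        (SD_A2 hreg hS hS' v ((Submodule.Quotient.mk_eq_zero _).1 ha))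
    let p' : (M ⧸ S') →ₗ[R] M ⧸ (S' ⊔ x • (⊤ : Submodule R M)) := Submodule.factor le_sup_left
    have hp' : Function.Surjective p' := Submodule.factor_surjective le_sup_left
    have hex : Function.Exact g p' := by
      intro a
      obtain ⟨v, rfl⟩ := S'.mkQ_surjective a
      constructor
      · intro h
        have h1 : v ∈ S' ⊔ x • (⊤ : Submodule R M) := (Submodule.Quotient.mk_eq_zero _).1 h
        obtain ⟨s, hs, w, hw, rfl⟩ := Submodule.mem_sup.1 h1
        obtain ⟨w', rfl⟩ := mem_xtop.1 hw
        refine ⟨S.mkQ w', ?_⟩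
        change (Submodule.Quotient.mk (x • w') : M ⧸ S') = Submodule.Quotient.mk (s + x • w')
        rw [Submodule.Quotient.eq]
        have : x • w' - (s + x • w') = - s := by abel
        rw [this]
        exact Submodule.neg_mem _ hs
      · rintro ⟨b, hb⟩
        obtain ⟨w, rfl⟩ := S.mkQ_surjective b
        rw [← hb]
        exact (Submodule.Quotient.mk_eq_zero _).2 (Submodule.mem_sup_right (mem_xtop.2 ⟨w, rfl⟩))
    exact sub_mid (ex3 ω hex hg hp' l) (hS.b l (by lia)) (hS'.b (l+1) hl)

theorem mainL (H : Can R n ω) (t : ℕ) : ∀ (M : Type) [AddCommGroup M] [Module R M]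
    [Module.Finite R M] (j : ℕ), j + t = n →
      dge R n ω t M → CMz R n ω t (X R j M ω) →
      ∃ T : Submodule R M, CMz R n ω t T ∧ dge R n ω (t+1) (M ⧸ T) := by
  have := H.fin
  induction t with
  | zero => intro M _ _ _ j _ _ _; exact L_zero H
  | succ t IH =>
    intro M _ _ _ j hj hM hE
    obtain ⟨x, hx, hreg, hregE⟩ := exists_reg2 (sf_of_dge H (dge_mono (by lia) hM))
      (sf_of_dge H (dge_mono (by lia) hE.2))
    choose S hS using SD_exists H t j hj IH hM hE x hx hreg hregE
    -- S 0 ≤ S k + x M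
    have hsum : ∀ k, ∀ u ∈ S 0, ∃ s ∈ S k, ∃ v, u = s + x • v := by
      intro k u hu
      cases k with
      | zero => exact ⟨u, hu, 0, by simp⟩
      | succ k =>
        have h1 := (hS 0).d _ (SD_B H hj hM hreg hregE (hS k) (hS (k+1))) (Submodule.mkQ _) (by
          intro u
          refine (Submodule.Quotient.mk_eq_zero _).2 (Submodule.mem_sup_right ?_)
          rw [zero_add, pow_one]
          exact mem_xtop.2 ⟨u, rfl⟩) u hu
        obtain ⟨s, hs, w, hw, rfl⟩ := Submodule.mem_sup.1 ((Submodule.Quotient.mk_eq_zero _).1 h1)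
        obtain ⟨v, rfl⟩ := mem_xtop.1 hw
        exact ⟨s, hs, v, rfl⟩
    let J : Ideal R := Module.annihilator R (X R j M ω)
    obtain ⟨r, y, hy⟩ := Submodule.fg_iff_exists_fin_generating_family.1 (IsNoetherian.noetherian J)
    let φ : M →ₗ[R] (Fin r → M) := LinearMap.pi fun i => y i • LinearMap.id
    have hyJ : ∀ i (e : X R j M ω), y i • e = 0 := by
      intro i
      have : y i ∈ J := by rw [← hy]; exact Submodule.subset_span ⟨i, rfl⟩
      exact Module.mem_annihilator.1 this
    have hφ : ∀ u, φ u = 0 ↔ ∀ i, y i • u = 0 := fun u => funext_iff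
    let T := LinearMap.ker φ
    have hTJ : ∀ y0 ∈ J, ∀ u ∈ T, y0 • u = 0 := by
      intro y0 hy0 u hu
      rw [← hy] at hy0
      refine Submodule.span_induction (p := fun z _ => z • u = 0) ?_ ?_ ?_ ?_ hy0
      · rintro _ ⟨i, rfl⟩; exact (hφ u).1 hu i
      · exact zero_smul _ _
      · intro a b _ _ ha hb; rw [add_smul, ha, hb, add_zero]
      · intro a b _ hb; rw [smul_assoc, hb, smul_zero]
    have hTdim : dlt R (t+1+1) T := by
      refine dlt_of_ann (A := X R j M ω) ?_ hE.1
      intro y0 hy0 u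
      exact Subtype.ext (hTJ y0 (Module.mem_annihilator.2 hy0) u u.2)
    have hx0 : x ^ (0+1) ∈ maximalIdeal R := by rwa [zero_add, pow_one]
    have hr0 : IsSMulRegular M (x ^ (0+1)) := by rwa [zero_add, pow_one]
    have hrT : IsSMulRegular T (x ^ (0+1)) := by
      intro a b hab
      exact Subtype.ext (hr0 (congrArg Subtype.val hab))
    have hTS : T ≤ S 0 := by
      intro u hu
      refine (hS 0).e (QuotSMulTop (x ^ (0+1)) T) (dlt_quot_of hx0 hrT hTdim)
        (Submodule.liftQ _ (px _ M ∘ₗ T.subtype) ?_) (px _ T ⟨u, hu⟩) u rfl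
      intro a ha
      obtain ⟨b, rfl⟩ := mem_xtop.1 ha
      exact (Submodule.Quotient.mk_eq_zero _).2 (mem_xtop.2 ⟨b.1, rfl⟩)
    have hST : ∀ u ∈ S 0, ∃ s ∈ T, ∃ v, u = s + x • v := by
      intro u hu
      obtain ⟨k, hk⟩ := AR φ x
      obtain ⟨s, hs, v, rfl⟩ := hsum k u hu
      obtain ⟨v', hv'⟩ := hk s (by
        choose w hw using fun i => (hS k).c (y i) (hyJ i) s hs
        exact ⟨w, funext hw⟩)
      exact ⟨_, hv', v + v', by rw [smul_add]; abel⟩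
    have hregQ : IsSMulRegular (M ⧸ T) x := by
      intro a b hab
      obtain ⟨a, rfl⟩ := T.mkQ_surjective a
      obtain ⟨b, rfl⟩ := T.mkQ_surjective b
      have h1 : x • (a - b) ∈ T := by
        rw [smul_sub]
        exact (Submodule.Quotient.eq T).1 hab
      refine (Submodule.Quotient.eq T).2 ?_
      refine (hφ _).2 fun i => ?_
      apply hreg
      change x • y i • (a - b) = x • 0
      rw [smul_zero, smul_comm]
      exact (hφ _).1 h1 i
    have hker : LinearMap.ker (px x (M ⧸ T) ∘ₗ T.mkQ) = S 0 := by
      ext u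
      constructor
      · intro h
        have h1 : T.mkQ u ∈ x • (⊤ : Submodule R (M ⧸ T)) := (Submodule.Quotient.mk_eq_zero _).1 h
        obtain ⟨b, hb⟩ := mem_xtop.1 h1
        obtain ⟨b, rfl⟩ := T.mkQ_surjective b
        have h2 : u - x • b ∈ T := (Submodule.Quotient.eq T).1 hb.symm
        have h3 : x • b ∈ S 0 := by simpa using (hS 0).a b
        have := (S 0).add_mem (hTS h2) h3
        simpa using this
      · intro h
        obtain ⟨s, hs, v, rfl⟩ := hST u h
        refine (Submodule.Quotient.mk_eq_zero _).2 (mem_xtop.2 ⟨T.mkQ v, ?_⟩)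
        change (Submodule.Quotient.mk (x • v) : M ⧸ T) = Submodule.Quotient.mk (s + x • v)
        rw [Submodule.Quotient.eq]
        have : x • v - (s + x • v) = - s := by abel
        rw [this]
        exact Submodule.neg_mem _ hs
    have hQ : dge R n ω (t+1+1) (M ⧸ T) := by
      refine (D1 H hx hregQ).2 ?_
      refine dge_equiv (LinearMap.quotKerEquivOfSurjective (px x (M ⧸ T) ∘ₗ T.mkQ)
        ((px_surj _).comp T.mkQ_surjective)).symm ?_
      rw [hker]
      exact (hS 0).b
    refine ⟨T, ⟨hTdim, ?_⟩, hQ⟩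
    exact dge_left (LinearMap.exact_subtype_mkQ T) (Submodule.injective_subtype _)
      (Submodule.mkQ_surjective _) hM (dge_mono (by lia) hQ)

end mainL
end Pesk

namespace Pesk
section fin
open IsLocalRing Pointwise
variable {R : Type} [CommRing R] [IsNoetherianRing R] [IsLocalRing R]
variable {A B C : Type} [AddCommGroup A] [Module R A] [AddCommGroup B] [Module R B]
  [AddCommGroup C] [Module R C]
variable {M : Type} [AddCommGroup M] [Module R M]
variable {n : ℕ} {ω : Type} [AddCommGroup ω] [Module R ω]

lemma iso_g {f : A →ₗ[R] B} {g : B →ₗ[R] C} (h : Function.Exact f g)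
    (hf : Function.Injective f) (hg : Function.Surjective g) (j : ℕ)
    (h1 : Subsingleton (X R j A ω)) (h2 : ∀ m, m + 1 = j → Subsingleton (X R m A ω)) :
    Nonempty (X R j C ω ≃ₗ[R] X R j B ω) := by
  refine ⟨LinearEquiv.ofBijective (eMap ω j g) ⟨?_, ?_⟩⟩
  · cases j with
    | zero => exact ex0 ω hg
    | succ j =>
      rw [injective_iff_map_eq_zero]
      intro e he
      obtain ⟨e', rfl⟩ := (ex3 ω h hf hg j e).1 he
      have := h2 j rfl
      rw [Subsingleton.elim e' 0, map_zero]
  · intro e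
    exact (ex2 ω h hf hg j e).1 (Subsingleton.elim _ _)

lemma iso_f {f : A →ₗ[R] B} {g : B →ₗ[R] C} (h : Function.Exact f g)
    (hf : Function.Injective f) (hg : Function.Surjective g) (j : ℕ)
    (h1 : Subsingleton (X R j C ω)) (h2 : Subsingleton (X R (j+1) C ω)) :
    Nonempty (X R j B ω ≃ₗ[R] X R j A ω) := by
  refine ⟨LinearEquiv.ofBijective (eMap ω j f) ⟨?_, ?_⟩⟩
  · rw [injective_iff_map_eq_zero]
    intro e he
    obtain ⟨e', rfl⟩ := (ex2 ω h hf hg j e).1 he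
    rw [Subsingleton.elim e' 0, map_zero]
  · intro e
    exact (ex1 ω h hf hg j e).1 (Subsingleton.elim _ _)

lemma seq_step (H : Can R n ω) [Module.Finite R A] [Module.Finite R C]
    {f : A →ₗ[R] B} {g : B →ₗ[R] C} (h : Function.Exact f g)
    (hf : Function.Injective f) (hg : Function.Surjective g) {d : ℕ}
    (hA : ∀ i j, i + j = n → CMz R n ω i (X R j A ω))
    (hA0 : ∀ i j, i + j = n → d ≤ i → Subsingleton (X R j A ω))
    (hC : CMz R n ω d C) :
    (∀ i j, i + j = n → CMz R n ω i (X R j B ω)) ∧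
    (∀ i j, i + j = n → d < i → Subsingleton (X R j B ω)) := by
  have h2 : ∀ i j, i + j = n → d < i → Subsingleton (X R j B ω) := by
    intro i j hij hd
    exact sub_mid (ex2 ω h hf hg j) (F4 H hC (by lia)) (hA0 i j hij hd.le)
  refine ⟨fun i j hij => ?_, h2⟩
  rcases lt_trichotomy i d with hd | rfl | hd
  · obtain ⟨e⟩ := iso_f (ω := ω) h hf hg j (F4 H hC (by lia)) (F4 H hC (by lia))
    exact CMz_equiv e (hA i j hij)
  · obtain ⟨e⟩ := iso_g (ω := ω) h hf hg j (hA0 i j hij le_rfl)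
      (fun m hm => hA0 (i+1) m (by lia) (by lia))
    exact CMz_equiv e.symm (F5 H i C j hC (by lia))
  · exact CMz_sub (h2 i j hij hd) i

lemma subQuot_seq {N N' : Submodule R M} (hle : N ≤ N') :
    Function.Injective (Submodule.inclusion hle) ∧
    Function.Surjective (Submodule.comap N'.subtype N).mkQ ∧
    Function.Exact (Submodule.inclusion hle) (Submodule.comap N'.subtype N).mkQ := by
  refine ⟨Submodule.inclusion_injective hle, Submodule.mkQ_surjective _, ?_⟩
  intro a
  rw [Submodule.mkQ_apply, Submodule.Quotient.mk_eq_zero]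
  constructor
  · intro h
    exact ⟨⟨a.1, h⟩, rfl⟩
  · rintro ⟨b, rfl⟩
    exact b.2

lemma exists_dim (H : Can R n ω) [Module.Finite R A] (h : IsCM R (maximalIdeal R) A) :
    ∃ d : ℕ, mDim R A = (d : WithBot ℕ∞) ∧ CMz R n ω d A := by
  have hn : mDim R A ≤ (n : WithBot ℕ∞) := dlt_succ.1 (dlt_n H)
  have hb : mDim R A ≠ ⊥ := by
    intro hb
    have := h.1
    exact not_subsingleton A ((Module.supportDim_eq_bot_iff_subsingleton R A).1 hb)
  obtain ⟨a, ha⟩ := WithBot.ne_bot_iff_exists.1 hb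
  rw [← ha] at hn
  have hn' : a ≤ (n : ℕ∞) := WithBot.coe_le_coe.1 hn
  obtain ⟨d, rfl⟩ := ENat.ne_top_iff_exists.1 (ne_top_of_le_ne_top (ENat.coe_ne_top n) hn')
  exact ⟨d, ha.symm, ((F2 H d).1 ⟨h, ha.symm⟩).2⟩

theorem one_two (H : Can R n ω) [Module.Finite R M] (h : IsSeqCM R (maximalIdeal R) M) (i j : ℕ)
    (hij : i + j = n) : CMz R n ω i (X R j M ω) := by
  obtain ⟨r, F, h0, hr, hlt, hCM, hinc⟩ := h
  have hd : ∀ k, ∃ d : ℕ, k < r → mDim R (subQuot R (F k) (F (k+1))) = (d : WithBot ℕ∞) ∧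
      CMz R n ω d (subQuot R (F k) (F (k+1))) := by
    intro k
    by_cases hk : k < r
    · obtain ⟨d, hd⟩ := exists_dim H (hCM k hk)
      exact ⟨d, fun _ => hd⟩
    · exact ⟨0, fun h => absurd h hk⟩
  choose d hd using hd
  have hinv : ∀ k, k ≤ r → (∀ i j, i + j = n → CMz R n ω i (X R j (F k) ω)) ∧
      (k < r → ∀ i j, i + j = n → d k ≤ i → Subsingleton (X R j (F k) ω)) := by
    intro k
    induction k with
    | zero =>
      intro _
      have hs : Subsingleton (F 0) := by rw [h0]; infer_instance
      exact ⟨fun i j _ => CMz_sub (x_of_sub ω j) i, fun _ i j _ _ => x_of_sub ω j⟩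
    | succ k ih =>
      intro hk
      obtain ⟨ih1, ih2⟩ := ih (by lia)
      obtain ⟨s1, s2, s3⟩ := subQuot_seq (hlt k (by lia)).le
      obtain ⟨r1, r2⟩ := seq_step H s3 s1 s2 ih1 (ih2 (by lia)) (hd k (by lia)).2
      refine ⟨r1, fun hk' i j hij hdi => r2 i j hij ?_⟩
      have := hinc k hk'
      rw [(hd k (by lia)).1, (hd (k+1) hk').1] at this
      have : d k < d (k+1) := by exact_mod_cast this
      lia
  have h1 := (hinv r le_rfl).1 i j hij
  rw [hr] at h1
  exact CMz_equiv (eEquiv ω j Submodule.topEquiv) h1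

/-- filtration of a submodule with dimensions less than `t` -/
def Fil (t : ℕ) (N : Submodule R M) : Prop :=
  ∃ (r : ℕ) (F : ℕ → Submodule R M), F 0 = ⊥ ∧ F r = N ∧ (∀ i < r, F i < F (i + 1)) ∧
    (∀ i < r, IsCM R (maximalIdeal R) (subQuot R (F i) (F (i + 1)))) ∧
    (∀ i, i + 1 < r →
      mDim R (subQuot R (F i) (F (i + 1))) < mDim R (subQuot R (F (i + 1)) (F (i + 2)))) ∧
    (∀ i < r, mDim R (subQuot R (F i) (F (i + 1))) < (t : WithBot ℕ∞))

lemma Fil_ext (H : Can R n ω) [Module.Finite R M] {t : ℕ} {N N' : Submodule R M} (hN : Fil t N)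
    (hle : N ≤ N') (hC : CMz R n ω t (subQuot R N N')) : Fil (t+1) N' := by
  obtain ⟨r, F, h0, hr, hlt, hCM, hinc, hb⟩ := hN
  rcases eq_or_lt_of_le hle with rfl | hNN
  · exact ⟨r, F, h0, hr, hlt, hCM, hinc, fun i hi => lt_trans (hb i hi) (by exact_mod_cast Nat.lt_succ_self t)⟩
  obtain ⟨F', hF1, hF2⟩ : ∃ F' : ℕ → Submodule R M, (∀ i ≤ r, F' i = F i) ∧ F' (r+1) = N' :=
    ⟨fun i => if i ≤ r then F i else N', fun i hi => if_pos hi, if_neg (by lia)⟩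
  have hnt : Nontrivial (subQuot R N N') := by
    refine Submodule.Quotient.nontrivial_iff.2 ?_
    intro htop
    apply not_le_of_gt hNN
    intro u hu
    have : (⟨u, hu⟩ : N') ∈ Submodule.comap N'.subtype N := by rw [htop]; trivial
    exact this
  have hQ := (F2 H t).2 ⟨hnt, hC⟩
  have hF3 : F' r = N := by rw [hF1 r le_rfl, hr]
  refine ⟨r+1, F', by rw [hF1 0 (by lia), h0], hF2, ?_, ?_, ?_, ?_⟩
  · intro i hi
    rcases eq_or_lt_of_le (Nat.le_of_lt_succ hi) with rfl | hi
    · rw [hF2, hF3]; exact hNN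
    · rw [hF1 i (by lia), hF1 (i+1) (by lia)]; exact hlt i hi
  · intro i hi
    rcases eq_or_lt_of_le (Nat.le_of_lt_succ hi) with rfl | hi
    · rw [hF2, hF3]; exact hQ.1
    · rw [hF1 i (by lia), hF1 (i+1) (by lia)]; exact hCM i hi
  · intro i hi
    rcases eq_or_lt_of_le (Nat.le_of_lt_succ hi) with rfl | hi
    · rw [hF2, hF3, hQ.2, hF1 i (by lia), ← hr]; exact hb i (by lia)
    · rw [hF1 i (by lia), hF1 (i+1) (by lia), hF1 (i+2) (by lia)]; exact hinc i hi
  · intro i hi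
    rcases eq_or_lt_of_le (Nat.le_of_lt_succ hi) with rfl | hi
    · rw [hF2, hF3, hQ.2]; exact_mod_cast Nat.lt_succ_self t
    · rw [hF1 i (by lia), hF1 (i+1) (by lia)]
      exact lt_trans (hb i hi) (by exact_mod_cast Nat.lt_succ_self t)

lemma subQuot_comap (N : Submodule R M) (T : Submodule R (M ⧸ N)) :
    Nonempty (subQuot R N (T.comap N.mkQ) ≃ₗ[R] T) := by
  let g : T.comap N.mkQ →ₗ[R] T := N.mkQ.restrict (fun u hu => hu)
  have hg : Function.Surjective g := by
    rintro ⟨q, hq⟩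
    obtain ⟨u, rfl⟩ := N.mkQ_surjective q
    exact ⟨⟨u, hq⟩, rfl⟩
  have hk : Submodule.comap (T.comap N.mkQ).subtype N = LinearMap.ker g := by
    ext u
    rw [LinearMap.mem_ker, Subtype.ext_iff]
    exact (Submodule.Quotient.mk_eq_zero N).symm
  exact ⟨(Submodule.quotEquivOfEq _ _ hk).trans (LinearMap.quotKerEquivOfSurjective g hg)⟩

lemma quot_comap (N : Submodule R M) (T : Submodule R (M ⧸ N)) :
    Nonempty ((M ⧸ T.comap N.mkQ) ≃ₗ[R] (M ⧸ N) ⧸ T) := by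
  have hker : T.comap N.mkQ = LinearMap.ker (T.mkQ ∘ₗ N.mkQ) := by
    rw [LinearMap.ker_comp, Submodule.ker_mkQ]
  exact ⟨(Submodule.quotEquivOfEq _ _ hker).trans (LinearMap.quotKerEquivOfSurjective _
    (T.mkQ_surjective.comp N.mkQ_surjective))⟩

lemma three_one_aux (H : Can R n ω) [Module.Finite R M] (d : ℕ) (hdn : d ≤ n) (hd : dlt R (d+1) M)
    (s : ℕ) : ∀ (t : ℕ) (N : Submodule R M), t + s = d → dge R n ω t (M ⧸ N) →
    (∀ i j, i + j = n → t ≤ i → i < d → CMz R n ω i (X R j (M ⧸ N) ω)) → Fil t N →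
    Fil (d+1) (⊤ : Submodule R M) := by
  induction s with
  | zero =>
    intro t N ht hN _ hF
    obtain rfl : t = d := ht
    refine Fil_ext H hF le_top ?_
    obtain ⟨e⟩ := subQuot_comap N ⊤
    exact CMz_equiv (e.trans Submodule.topEquiv) ⟨dlt_surj _ N.mkQ_surjective hd, hN⟩
  | succ s ih =>
    intro t N ht hN hX hF
    obtain ⟨T, hT, hT'⟩ := mainL H t (M ⧸ N) (n - t) (by lia) hN
      (hX t (n-t) (by lia) le_rfl (by lia))
    obtain ⟨e⟩ := subQuot_comap N T
    obtain ⟨e'⟩ := quot_comap N T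
    refine ih (t+1) (T.comap N.mkQ) (by lia) (dge_equiv e' hT') ?_ ?_
    · intro i j hij hti hid
      obtain ⟨e''⟩ := iso_g (ω := ω) (LinearMap.exact_subtype_mkQ T) (Submodule.injective_subtype _)
        (Submodule.mkQ_surjective _) j (F4 H hT (by lia)) (fun m hm => F4 H hT (by lia))
      exact CMz_equiv ((eEquiv ω j e').symm.trans e'') (hX i j hij (by lia) hid)
    · refine Fil_ext H hF ?_ (CMz_equiv e hT)
      intro v hv
      rw [Submodule.mem_comap, Submodule.mkQ_apply, (Submodule.Quotient.mk_eq_zero N).2 hv]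
      exact Submodule.zero_mem _

theorem three_one (H : Can R n ω) [Module.Finite R M] (d : ℕ) (hdn : d ≤ n) (hd : dlt R (d+1) M)
    (hX : ∀ i j, i + j = n → i < d → CMz R n ω i (X R j M ω)) : IsSeqCM R (maximalIdeal R) M := by
  have h := three_one_aux H d hdn hd d 0 (⊥ : Submodule R M) (by lia) (dge_zero H) (by
    intro i j hij _ hid
    exact CMz_equiv (eEquiv ω j (Submodule.quotEquivOfEqBot ⊥ rfl)).symm (hX i j hij hid))
    ⟨0, fun _ => ⊥, rfl, rfl, by simp, by simp, by simp, by simp⟩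
  obtain ⟨r, F, h0, hr, hlt, hCM, hinc, _⟩ := h
  exact ⟨r, F, h0, hr, hlt, hCM, hinc⟩

lemma conv (H : Can R n ω) [Module.Finite R M] (i j : ℕ) :
    (Subsingleton (extC R j M ω) ∨ (IsCM R (maximalIdeal R) (extC R j M ω) ∧
      mDim R (extC R j M ω) = (i : WithBot ℕ∞))) ↔ CMz R n ω i (X R j M ω) := by
  have := H.fin
  obtain ⟨e⟩ := bridge R j M ω
  have : Module.Finite R (extC R j M ω) := Module.Finite.equiv e.symm
  rw [F2 H i]
  constructor
  · rintro (h | h)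
    · exact CMz_equiv e.symm (CMz_sub h i)
    · exact CMz_equiv e.symm h.2
  · intro h
    rcases subsingleton_or_nontrivial (extC R j M ω) with h1 | h1
    · exact Or.inl h1
    · exact Or.inr ⟨h1, CMz_equiv e h⟩

lemma can_of (hn : ringKrullDim R = (n : WithBot ℕ∞)) (hω : IsCanonicalModule R ω) : Can R n ω := by
  refine ⟨hω.1, hn, ?_, ?_⟩
  · intro j hj
    obtain ⟨e⟩ := bridge R j (R ⧸ maximalIdeal R) ω
    have := (hω.2 j).2 (by rw [hn]; exact_mod_cast hj)
    exact e.symm.toEquiv.subsingleton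
  · obtain ⟨e⟩ := bridge R n (R ⧸ maximalIdeal R) ω
    obtain ⟨e'⟩ := (hω.2 n).1 hn.symm
    exact (e.symm.trans e').toEquiv.nontrivial

theorem final (R : Type) [CommRing R] [IsNoetherianRing R] [IsLocalRing R]
    (n : ℕ) (hn : ringKrullDim R = (n : WithBot ℕ∞))
    (ω : Type) [AddCommGroup ω] [Module R ω] (hω : IsCanonicalModule R ω)
    (M : Type) [AddCommGroup M] [Module R M] [Module.Finite R M]
    (d : ℕ) (hd : mDim R M = (d : WithBot ℕ∞)) :
    List.TFAE
      [IsSeqCM R (maximalIdeal R) M,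
       ∀ i ≤ d,
         Subsingleton (extC R (n - i) M ω) ∨
           (IsCM R (maximalIdeal R) (extC R (n - i) M ω) ∧
             mDim R (extC R (n - i) M ω) = (i : WithBot ℕ∞)),
       ∀ i, 1 ≤ i → i ≤ d - 1 →
         Subsingleton (extC R (n - i) M ω) ∨
           (IsCM R (maximalIdeal R) (extC R (n - i) M ω) ∧
             mDim R (extC R (n - i) M ω) = (i : WithBot ℕ∞))] := by
  have H := can_of hn hω
  have := H.fin
  have hdn : d ≤ n := by
    have : mDim R M ≤ (n : WithBot ℕ∞) := dlt_succ.1 (dlt_n H)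
    rw [hd] at this
    exact_mod_cast this
  have hd' : dlt R (d+1) M := dlt_succ.2 hd.le
  tfae_have 1 → 2 := by
    intro h i hi
    exact (conv H i (n-i)).2 (one_two H h i (n-i) (by lia))
  tfae_have 2 → 3 := fun h i _ hi => h i (by lia)
  tfae_have 3 → 1 := by
    intro h
    refine three_one H d hdn hd' ?_
    intro i j hij hid
    rcases Nat.eq_zero_or_pos i with rfl | hi
    · exact ⟨F6 H hij, dge_zero H⟩
    · obtain rfl : j = n - i := by lia
      exact (conv H i (n-i)).1 (h i hi (by lia))
  tfae_finish

end fin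
end Pesk

open IsLocalRing in
/-- (Peskine)  Let `R` be a Cohen-Macaulay Noetherian local ring of dimension
`n` with canonical module `ω`, and `M` a finitely generated `R`-module of dimension `d`.
The following are equivalent: (1) `M` is sequentially Cohen-Macaulay;
(2) `Ext_R^{n-i}(M, ω)` is either `0` or Cohen-Macaulay of dimension `i` for all `0 ≤ i ≤ d`;
(3) `Ext_R^{n-i}(M, ω)` is either `0` or Cohen-Macaulay of dimension `i` for all
`1 ≤ i ≤ d - 1`. -/
theorem stmt12 (R : Type) [CommRing R] [IsNoetherianRing R] [IsLocalRing R]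
    (hCMring : IsCMLocalRing R) (n : ℕ) (hn : ringKrullDim R = (n : WithBot ℕ∞))
    (ω : Type) [AddCommGroup ω] [Module R ω] (hω : IsCanonicalModule R ω)
    (M : Type) [AddCommGroup M] [Module R M] [Module.Finite R M]
    (d : ℕ) (hd : mDim R M = (d : WithBot ℕ∞)) :
    List.TFAE
      [IsSeqCM R (maximalIdeal R) M,
       ∀ i ≤ d,
         Subsingleton (extC R (n - i) M ω) ∨
           (IsCM R (maximalIdeal R) (extC R (n - i) M ω) ∧
             mDim R (extC R (n - i) M ω) = (i : WithBot ℕ∞)),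
       ∀ i, 1 ≤ i → i ≤ d - 1 →
         Subsingleton (extC R (n - i) M ω) ∨
           (IsCM R (maximalIdeal R) (extC R (n - i) M ω) ∧
             mDim R (extC R (n - i) M ω) = (i : WithBot ℕ∞))] := by
  exact Pesk.final R n hn ω hω M d hd
end

section
/- Let R be a Cohen-Macaulay ring with canonical module ω_R, and let M and N be finitely generated R-modules. Then M and N are both sequentially Cohen-Macaulay if and only if M ⊕ N is sequentially Cohen-Macaulay. -/
open CategoryTheory

theorem projRes_zero_iff {R : Type} [CommRing R] {X Y : ModuleCat.{0} R}
    (P : ProjectiveResolution X) :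
    (∀ f : P.complex.X 0 ⟶ Y, P.complex.d 1 0 ≫ f = 0 → f = 0) ↔ Subsingleton (X ⟶ Y) := by
  constructor
  · intro h
    refine subsingleton_of_forall_eq 0 fun x => ?_
    have h0 : P.complex.d 1 0 ≫ P.π.f 0 = 0 := P.complex_d_comp_π_f_zero
    let π : P.complex.X 0 ⟶ X := P.π.f 0
    have hepi : Epi π := inferInstanceAs (Epi (P.π.f 0))
    have h1 : P.complex.d 1 0 ≫ π = 0 := h0
    have := h (π ≫ x) (by rw [← Category.assoc, h1, Limits.zero_comp])
    exact (cancel_epi π).1 (by rw [this, Limits.comp_zero])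
  · intro h f hf
    let g : X ⟶ Y := P.isColimitCokernelCofork.desc (Limits.CokernelCofork.ofπ f hf)
    let π : P.complex.X 0 ⟶ X := P.π.f 0
    have hg : π ≫ g = f := P.isColimitCokernelCofork.fac _ Limits.WalkingParallelPair.one
    have : g = 0 := Subsingleton.elim _ _
    rw [← hg, this, Limits.comp_zero]

theorem extC_sub_iff (R : Type) [CommRing R] (n : ℕ) (A B : Type)
    [AddCommGroup A] [Module R A] [AddCommGroup B] [Module R B] :
    Subsingleton (extC R n A B) ↔
      Subsingleton (Abelian.Ext.{0} (ModuleCat.of R A) (ModuleCat.of R B) n) := by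
  let P : ProjectiveResolution (ModuleCat.of R A) := projectiveResolution _
  have e := P.isoExt (R := R) n (ModuleCat.of R B)
  have h1 : Subsingleton (extC R n A B) ↔
      (P.complex.linearYonedaObj R (ModuleCat.of R B)).ExactAt n := by
    rw [HomologicalComplex.exactAt_iff_isZero_homology, ← e.isZero_iff,
      ModuleCat.isZero_iff_subsingleton]
  rw [h1]
  rcases n with _ | n
  · rw [HomologicalComplex.exactAt_iff' _ 0 0 1 (by simp) (by simp)]
    rw [ShortComplex.moduleCat_exact_iff, Abelian.Ext.addEquiv₀.subsingleton_congr]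
    rw [← projRes_zero_iff P]
    constructor
    · intro h f hf
      obtain ⟨g, hg⟩ := h f hf
      have h0 : P.complex.d 0 0 ≫ g = f := hg
      have h1 : P.complex.d 0 0 = 0 := P.complex.shape 0 0 (by simp)
      rw [← h0, h1]
      exact Limits.zero_comp
    · intro h f hf
      refine ⟨0, ?_⟩
      rw [map_zero]; exact (h f hf).symm
  · rw [HomologicalComplex.exactAt_iff' _ n (n+1) (n+2) (by simp) (by simp)]
    rw [ShortComplex.moduleCat_exact_iff]
    constructor
    · intro h
      refine subsingleton_of_forall_eq 0 fun x => ?_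
      obtain ⟨f, hf, rfl⟩ := P.extMk_surjective x (n+2) rfl
      rw [P.extMk_eq_zero_iff _ _ _ _ n rfl]
      obtain ⟨g, hg⟩ := h f hf
      exact ⟨g, hg⟩
    · intro h f hf
      exact (P.extMk_eq_zero_iff f (n+2) rfl hf n rfl).1 (Subsingleton.elim _ _)

theorem extC_prod_iff (R : Type) [CommRing R] (n : ℕ) (A B C : Type)
    [AddCommGroup A] [Module R A] [AddCommGroup B] [Module R B] [AddCommGroup C] [Module R C] :
    Subsingleton (extC R n A (B × C)) ↔
      Subsingleton (extC R n A B) ∧ Subsingleton (extC R n A C) := by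
  simp only [extC_sub_iff]
  let X := ModuleCat.of R A
  let i₁ : ModuleCat.of R B ⟶ ModuleCat.of R (B × C) := ModuleCat.ofHom (LinearMap.inl R B C)
  let i₂ : ModuleCat.of R C ⟶ ModuleCat.of R (B × C) := ModuleCat.ofHom (LinearMap.inr R B C)
  let p₁ : ModuleCat.of R (B × C) ⟶ ModuleCat.of R B := ModuleCat.ofHom (LinearMap.fst R B C)
  let p₂ : ModuleCat.of R (B × C) ⟶ ModuleCat.of R C := ModuleCat.ofHom (LinearMap.snd R B C)
  have h1 : i₁ ≫ p₁ = 𝟙 _ := by ext; rfl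
  have h2 : i₂ ≫ p₂ = 𝟙 _ := by ext; rfl
  have h3 : p₁ ≫ i₁ + p₂ ≫ i₂ = 𝟙 _ := by ext x <;> simp [i₁, i₂, p₁, p₂]
  constructor
  · intro h
    constructor
    · refine subsingleton_of_forall_eq 0 fun x => ?_
      rw [← x.comp_mk₀_id, ← h1, ← Abelian.Ext.mk₀_comp_mk₀, ← Abelian.Ext.comp_assoc_of_third_deg_zero,
        Subsingleton.elim (x.comp (Abelian.Ext.mk₀ i₁) (add_zero n)) 0, Abelian.Ext.zero_comp]
    · refine subsingleton_of_forall_eq 0 fun x => ?_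
      rw [← x.comp_mk₀_id, ← h2, ← Abelian.Ext.mk₀_comp_mk₀, ← Abelian.Ext.comp_assoc_of_third_deg_zero,
        Subsingleton.elim (x.comp (Abelian.Ext.mk₀ i₂) (add_zero n)) 0, Abelian.Ext.zero_comp]
  · rintro ⟨h, h'⟩
    refine subsingleton_of_forall_eq 0 fun x => ?_
    rw [← x.comp_mk₀_id, ← h3, Abelian.Ext.mk₀_add, Abelian.Ext.comp_add,
      ← Abelian.Ext.mk₀_comp_mk₀, ← Abelian.Ext.mk₀_comp_mk₀, ← Abelian.Ext.comp_assoc_of_third_deg_zero,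
      ← Abelian.Ext.comp_assoc_of_third_deg_zero,
      Subsingleton.elim (x.comp (Abelian.Ext.mk₀ p₁) (add_zero n)) 0,
      Subsingleton.elim (x.comp (Abelian.Ext.mk₀ p₂) (add_zero n)) 0, Abelian.Ext.zero_comp,
      Abelian.Ext.zero_comp, add_zero]

theorem extC_congr (R : Type) [CommRing R] (n : ℕ) (A B C : Type)
    [AddCommGroup A] [Module R A] [AddCommGroup B] [Module R B] [AddCommGroup C] [Module R C]
    (e : B ≃ₗ[R] C) :
    Subsingleton (extC R n A B) ↔ Subsingleton (extC R n A C) := by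
  let i := ((Ext R (ModuleCat R) n).obj (Opposite.op (ModuleCat.of R A))).mapIso e.toModuleIso
  exact i.toLinearEquiv.toEquiv.subsingleton_congr



open Pointwise in
theorem key_assoc (R : Type) [CommRing R] [IsNoetherianRing R] [IsLocalRing R] (d : ℕ) :
    ∀ (M : Type) [AddCommGroup M] [Module R M] [Module.Finite R M],
    (∀ i < d, Subsingleton (extC R i (R ⧸ IsLocalRing.maximalIdeal R) M)) →
    ∀ p : PrimeSpectrum R, p.asIdeal ∈ associatedPrimes R M → (d : ℕ∞) ≤ Order.coheight p := by
  induction d with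
  | zero => intros; simp
  | succ d ih =>
    intro M _ _ _ h p hp
    simp only [extC_sub_iff] at h
    have h0 := h 0 (by omega)
    have : Subsingleton (ModuleCat.of R (R ⧸ IsLocalRing.maximalIdeal R) ⟶ ModuleCat.of R M) :=
      Abelian.Ext.addEquiv₀.subsingleton_congr.mp h0
    have : Subsingleton ((R ⧸ IsLocalRing.maximalIdeal R) →ₗ[R] M) :=
      (ModuleCat.homAddEquiv (M := ModuleCat.of R (R ⧸ IsLocalRing.maximalIdeal R))
        (N := ModuleCat.of R M)).symm.toEquiv.subsingleton
    obtain ⟨x, hxm, hx⟩ := IsSMulRegular.subsingleton_linearMap_iff.mp this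
    rw [Ideal.annihilator_quotient] at hxm
    have h_ext' : ∀ i < d, Subsingleton (extC R i (R ⧸ IsLocalRing.maximalIdeal R)
        (QuotSMulTop x M)) := by
      intro i hi
      rw [extC_sub_iff]
      have zero1 := AddCommGrpCat.isZero_of_iff_subsingleton.mpr (h i (by omega))
      have zero2 := AddCommGrpCat.isZero_of_iff_subsingleton.mpr (h (i + 1) (by omega))
      have hx' : IsSMulRegular (ModuleCat.of R M) x := hx
      exact AddCommGrpCat.subsingleton_of_isZero <| Limits.IsZero.of_iso (Limits.isZero_zero _) <|
        (ShortComplex.Exact.isZero_of_both_zeros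
        ((Abelian.Ext.covariant_sequence_exact₃' _ hx'.smulShortComplex_shortExact) i (i + 1) rfl)
        (zero1.eq_zero_of_src _) (zero2.eq_zero_of_tgt _)).isoZero
    obtain ⟨hpp, z, hz⟩ := isAssociatedPrime_iff.1 hp
    have hz' : ∀ r, r ∈ p.asIdeal ↔ r • z = 0 := by
      intro r; rw [hz]; simp [Submodule.mem_colon_singleton]
    have hz0 : z ≠ 0 := by
      rintro rfl
      exact p.isPrime.ne_top ((Ideal.eq_top_iff_one _).2 ((hz' 1).2 (by simp)))
    let U : Submodule R M := Submodule.torsionBySet R M (p.asIdeal : Set R)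
    have hzU : z ∈ U := by
      rw [Submodule.mem_torsionBySet_iff]
      rintro ⟨r, hr⟩
      exact (hz' r).1 hr
    have hU : ∃ u ∈ U, u ∉ x • (⊤ : Submodule R M) := by
      by_contra! hcon
      have : U = ⊥ := by
        apply Submodule.eq_bot_of_le_smul_of_le_jacobson_bot (Ideal.span {x}) U
          (IsNoetherian.noetherian U)
        · intro u hu
          obtain ⟨w, -, hw⟩ := (Submodule.mem_smul_pointwise_iff_exists _ _ _).1 (hcon u hu)
          rw [← hw]
          refine Submodule.smul_mem_smul (Ideal.mem_span_singleton_self x) ?_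
          rw [Submodule.mem_torsionBySet_iff] at hu ⊢
          intro a
          have := hu a
          apply hx
          simp only [smul_zero]
          rw [smul_comm, hw]; exact this
        · rw [IsLocalRing.jacobson_eq_maximalIdeal _ bot_ne_top]
          simpa [Ideal.span_le] using hxm
      rw [this] at hzU
      exact hz0 (by simpa using hzU)
    obtain ⟨u, hu, hux⟩ := hU
    have hune : (Submodule.Quotient.mk u : QuotSMulTop x M) ≠ 0 := by
      rwa [Ne, Submodule.Quotient.mk_eq_zero]
    obtain ⟨q, hq, hle⟩ := exists_le_isAssociatedPrime_of_isNoetherianRing R _ hune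
    have hle' : ∀ r : R, r • u ∈ x • (⊤ : Submodule R M) → r ∈ q := by
      intro r hr
      apply hle
      rw [Submodule.mem_colon_singleton, ← Submodule.Quotient.mk_smul, Submodule.mem_bot,
        Submodule.Quotient.mk_eq_zero]
      exact hr
    have hpq : p < ⟨q, hq.1⟩ := by
      rw [lt_iff_le_not_ge]
      constructor
      · intro r hr
        apply hle'
        rw [Submodule.mem_torsionBySet_iff] at hu
        have := hu ⟨r, hr⟩
        change r • u = 0 at this
        rw [this]; exact zero_mem _
      · intro hcon
        have hxq : x ∈ q := hle' x (Submodule.smul_mem_pointwise_smul _ _ _ trivial)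
        have : x ∈ p.asIdeal := hcon hxq
        rw [hz'] at this
        exact hz0 (hx (by simpa using this))
    have := ih (QuotSMulTop x M) h_ext' ⟨q, hq.1⟩ hq
    calc ((d + 1 : ℕ) : ℕ∞) = d + 1 := by simp
      _ ≤ Order.coheight (⟨q, hq.1⟩ : PrimeSpectrum R) + 1 := by gcongr
      _ ≤ _ := Order.coheight_add_one_le hpq


theorem le_mDepth_iff (R : Type) [CommRing R] (I : Ideal R) (M : Type)
    [AddCommGroup M] [Module R M] (c : ℕ) :
    (c : ℕ∞) ≤ mDepth R I M ↔ ∀ i < c, Subsingleton (extC R i (R ⧸ I) M) := by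
  unfold mDepth
  rw [le_sInf_iff]
  constructor
  · intro h i hi
    by_contra hcon
    rw [not_subsingleton_iff_nontrivial] at hcon
    have := h i ⟨i, rfl, hcon⟩
    rw [Nat.cast_le] at this
    omega
  · rintro h _ ⟨j, rfl, hj⟩
    rw [Nat.cast_le]
    by_contra! hlt
    have := h j hlt
    exact not_subsingleton _ this

theorem mDim_le_iff (R : Type) [CommRing R] (M : Type)
    [AddCommGroup M] [Module R M] (c : ℕ∞) :
    mDim R M ≤ c ↔ ∀ p ∈ Module.support R M, Order.coheight p ≤ c := by
  unfold mDim
  have hco : ∀ p : Module.support R M, Order.coheight p = Order.coheight p.1 := by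
    apply Order.coheight_eq_of_strictMono (fun p : Module.support R M => p.1)
    · intro a b hab; exact hab
    · intro a b hab
      exact ⟨⟨b, Module.mem_support_mono hab.le a.2⟩, hab, rfl⟩
  rw [Order.krullDim_eq_iSup_coheight, iSup_le_iff]
  simp only [hco, Subtype.forall, WithBot.coe_le_coe]

/-- The elements whose support consists of primes of coheight less than `c`. -/
def dimSub (R : Type) [CommRing R] (M : Type) [AddCommGroup M] [Module R M] (c : ℕ∞) :
    Submodule R M where
  carrier := {m | ∀ p : PrimeSpectrum R, c ≤ Order.coheight p → ∃ s ∉ p.asIdeal, s • m = 0}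
  zero_mem' := fun p _ => ⟨1, p.asIdeal.one_notMem, by simp⟩
  add_mem' := by
    intro a b ha hb p hp
    obtain ⟨s, hs, h1⟩ := ha p hp
    obtain ⟨t, ht, h2⟩ := hb p hp
    refine ⟨s * t, fun h => (p.isPrime.mem_or_mem h).elim hs ht, ?_⟩
    rw [smul_add, mul_smul, mul_smul, h2, smul_comm, h1]; simp
  smul_mem' := by
    intro r a ha p hp
    obtain ⟨s, hs, h1⟩ := ha p hp
    exact ⟨s, hs, by rw [smul_comm, h1, smul_zero]⟩

section
variable {R : Type} [CommRing R] {M : Type} [AddCommGroup M] [Module R M]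

theorem mem_dimSub {c : ℕ∞} {m : M} : m ∈ dimSub R M c ↔
    ∀ p : PrimeSpectrum R, c ≤ Order.coheight p → ∃ s ∉ p.asIdeal, s • m = 0 := Iff.rfl

theorem dimSub_mono {c d : ℕ∞} (h : c ≤ d) : dimSub R M c ≤ dimSub R M d :=
  fun _ hm p hp => hm p (h.trans hp)

theorem dimSub_zero : dimSub R M 0 = ⊥ := by
  rw [eq_bot_iff]
  intro m hm
  by_contra h0
  have h1 : Ideal.span {r : R | r • m = 0} ≠ ⊤ := by
    intro h
    have : (1 : R) ∈ LinearMap.ker (LinearMap.toSpanSingleton R M m) := by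
      have h2 : Ideal.span {r : R | r • m = 0} ≤ LinearMap.ker (LinearMap.toSpanSingleton R M m) := by
        rw [Ideal.span_le]; intro r hr; simpa using hr
      apply h2; rw [h]; trivial
    exact h0 (by simpa using this)
  obtain ⟨P, hP, hle⟩ := Ideal.exists_le_maximal _ h1
  obtain ⟨s, hs, hsm⟩ := hm ⟨P, hP.isPrime⟩ bot_le
  exact hs (hle (Ideal.subset_span hsm))

theorem dimSub_map {N : Type} [AddCommGroup N] [Module R N] (f : M →ₗ[R] N) {c : ℕ∞} {m : M}
    (hm : m ∈ dimSub R M c) : f m ∈ dimSub R N c := by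
  intro p hp
  obtain ⟨s, hs, h⟩ := hm p hp
  exact ⟨s, hs, by rw [← map_smul, h, map_zero]⟩

theorem dimSub_eq_top {c : ℕ∞} (h : mDim R M < c) : dimSub R M c = ⊤ := by
  rw [eq_top_iff]
  intro m _ p hp
  have : p ∉ Module.support R M := by
    intro hps
    by_cases hb : mDim R M = ⊥
    · have := (mDim_le_iff R M 0).1 (by rw [hb]; exact bot_le) p hps
      have h2 : IsEmpty (Module.support R M) := Order.krullDim_eq_bot_iff.1 hb
      exact h2.elim ⟨p, hps⟩
    · obtain ⟨e, he⟩ := WithBot.ne_bot_iff_exists.1 hb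
      have := (mDim_le_iff R M e).1 he.ge p hps
      rw [← he, WithBot.coe_lt_coe] at h
      exact absurd (hp.trans this) (not_le.2 h)
  obtain ⟨s, hs, h⟩ := Module.notMem_support_iff'.1 this m
  exact ⟨s, hs, h⟩

theorem dimSub_eq_bot [IsNoetherianRing R] [IsLocalRing R] [Module.Finite R M] {c : ℕ}
    (h : ∀ i < c, Subsingleton (extC R i (R ⧸ IsLocalRing.maximalIdeal R) M)) :
    dimSub R M c = ⊥ := by
  rw [eq_bot_iff]
  intro m hm
  by_contra h0
  obtain ⟨q, hq, hle⟩ := exists_le_isAssociatedPrime_of_isNoetherianRing R m h0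
  obtain ⟨s, hs, hsm⟩ := hm ⟨q, hq.1⟩ (key_assoc R c M h ⟨q, hq.1⟩ hq)
  exact hs (hle (by rw [Submodule.mem_colon_singleton, hsm]; exact zero_mem _))

theorem le_mDim [IsNoetherianRing R] [IsLocalRing R] [Module.Finite R M] [Nontrivial M] {c : ℕ}
    (h : ∀ i < c, Subsingleton (extC R i (R ⧸ IsLocalRing.maximalIdeal R) M)) :
    ((c : ℕ∞) : WithBot ℕ∞) ≤ mDim R M := by
  by_contra! hlt
  have h1 := dimSub_eq_top hlt
  rw [dimSub_eq_bot h] at h1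
  exact bot_ne_top h1

/-- The subquotient. -/
abbrev dimQ (R : Type) [CommRing R] (M : Type) [AddCommGroup M] [Module R M] (c : ℕ) : Type :=
  subQuot R (dimSub R M c) (dimSub R M ((c + 1 : ℕ) : ℕ∞))

theorem mDim_dimQ (c : ℕ) : mDim R (dimQ R M c) ≤ (c : ℕ∞) := by
  rw [mDim_le_iff]
  intro p hp
  by_contra! hlt
  have hlt' : ((c + 1 : ℕ) : ℕ∞) ≤ Order.coheight p := by
    push_cast; exact Order.add_one_le_of_lt hlt
  revert hp
  rw [imp_false, Module.notMem_support_iff']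
  intro m
  obtain ⟨⟨m, hm⟩, rfl⟩ := Submodule.Quotient.mk_surjective _ m
  obtain ⟨s, hs, h⟩ := hm p hlt'
  refine ⟨s, hs, ?_⟩
  rw [← Submodule.Quotient.mk_smul]
  have : s • (⟨m, hm⟩ : dimSub R M ((c + 1 : ℕ) : ℕ∞)) = 0 := Subtype.ext h
  rw [this]; rfl

theorem dimQ_CM [IsNoetherianRing R] [IsLocalRing R] [Module.Finite R M] (c : ℕ)
    (h : ∀ i < c, Subsingleton (extC R i (R ⧸ IsLocalRing.maximalIdeal R) (dimQ R M c)))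
    (hn : Nontrivial (dimQ R M c)) :
    IsCM R (IsLocalRing.maximalIdeal R) (dimQ R M c) ∧ mDim R (dimQ R M c) = (c : ℕ∞) := by
  have hd := mDim_dimQ (R := R) (M := M) c
  have h1 := le_mDim h
  have h2 := le_antisymm hd h1
  refine ⟨⟨hn, ?_⟩, h2⟩
  rw [h2, WithBot.coe_inj]
  refine le_antisymm ?_ ((le_mDepth_iff _ _ _ _).2 h)
  by_contra! hlt
  have hlt' : ((c + 1 : ℕ) : ℕ∞) ≤ mDepth R (IsLocalRing.maximalIdeal R) (dimQ R M c) := by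
    push_cast; exact Order.add_one_le_of_lt hlt
  have := (le_mDim ((le_mDepth_iff _ _ _ _).1 hlt')).trans hd
  rw [WithBot.coe_le_coe, Nat.cast_le] at this
  omega

/-- Criterion in terms of the dimension filtration. -/
def DimCrit (R : Type) [CommRing R] [IsLocalRing R] (M : Type) [AddCommGroup M] [Module R M] :
    Prop :=
  ∀ c : ℕ, ∀ i < c, Subsingleton (extC R i (R ⧸ IsLocalRing.maximalIdeal R) (dimQ R M c))

theorem dimSub_prod {N : Type} [AddCommGroup N] [Module R N] (c : ℕ∞) :
    dimSub R (M × N) c = (dimSub R M c).prod (dimSub R N c) := by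
  ext ⟨m, n⟩
  rw [Submodule.mem_prod]
  constructor
  · intro h
    exact ⟨dimSub_map (LinearMap.fst R M N) h, dimSub_map (LinearMap.snd R M N) h⟩
  · rintro ⟨h1, h2⟩
    have := add_mem (dimSub_map (LinearMap.inl R M N) h1) (dimSub_map (LinearMap.inr R M N) h2)
    simpa using this

theorem subQuot_prod {N : Type} [AddCommGroup N] [Module R N] (A A' : Submodule R M)
    (B B' : Submodule R N) :
    Nonempty (subQuot R (A.prod B) (A'.prod B') ≃ₗ[R] (subQuot R A A' × subQuot R B B')) := by
  let f1 : (A'.prod B') →ₗ[R] A' := ((LinearMap.fst R M N).domRestrict _).codRestrict _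
    (fun x => x.2.1)
  let f2 : (A'.prod B') →ₗ[R] B' := ((LinearMap.snd R M N).domRestrict _).codRestrict _
    (fun x => x.2.2)
  let f : (A'.prod B') →ₗ[R] (subQuot R A A' × subQuot R B B') :=
    ((Submodule.mkQ _).comp f1).prod ((Submodule.mkQ _).comp f2)
  have hf : Function.Surjective f := by
    rintro ⟨a, b⟩
    obtain ⟨a, rfl⟩ := Submodule.Quotient.mk_surjective _ a
    obtain ⟨b, rfl⟩ := Submodule.Quotient.mk_surjective _ b
    exact ⟨⟨(a.1, b.1), ⟨a.2, b.2⟩⟩, rfl⟩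
  have hk : LinearMap.ker f = Submodule.comap (A'.prod B').subtype (A.prod B) := by
    ext x
    rw [LinearMap.mem_ker, Submodule.mem_comap]
    change (Submodule.Quotient.mk (f1 x), Submodule.Quotient.mk (f2 x)) = (0 : subQuot R A A' × subQuot R B B') ↔ _
    rw [Prod.mk_eq_zero, Submodule.Quotient.mk_eq_zero, Submodule.Quotient.mk_eq_zero]
    rfl
  exact ⟨(Submodule.quotEquivOfEq _ _ hk.symm).trans (f.quotKerEquivOfSurjective hf)⟩

theorem dimCrit_prod [IsLocalRing R] {N : Type} [AddCommGroup N] [Module R N] :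
    (DimCrit R M ∧ DimCrit R N) ↔ DimCrit R (M × N) := by
  unfold DimCrit
  rw [← forall_and]
  refine forall_congr' fun c => ?_
  rw [← forall_and]
  refine forall_congr' fun i => ?_
  rw [← imp_and]
  refine imp_congr_right fun _ => ?_
  rw [← extC_prod_iff]
  unfold dimQ
  rw [dimSub_prod, dimSub_prod]
  obtain ⟨e⟩ := subQuot_prod (dimSub R M c) (dimSub R M ((c + 1 : ℕ) : ℕ∞))
    (dimSub R N c) (dimSub R N ((c + 1 : ℕ) : ℕ∞))
  exact (extC_congr R i _ _ _ e).symm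

theorem subQuot_subsingleton {A B : Submodule R M} (h : B ≤ A) : Subsingleton (subQuot R A B) := by
  rw [Submodule.Quotient.subsingleton_iff, Submodule.comap_subtype_eq_top]
  exact h

theorem subQuot_nontrivial {A B : Submodule R M} (h : ¬ B ≤ A) : Nontrivial (subQuot R A B) := by
  rw [Submodule.Quotient.nontrivial_iff, Ne, Submodule.comap_subtype_eq_top]
  exact h

theorem extC_of_sub {I : Ideal R} {i : ℕ} (h : Subsingleton M) :
    Subsingleton (extC R i (R ⧸ I) M) := by
  have hz : Limits.IsZero (ModuleCat.of R M) := ModuleCat.isZero_of_subsingleton _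
  rw [extC_sub_iff]
  refine subsingleton_of_forall_eq 0 fun x => ?_
  rw [← x.comp_mk₀_id, hz.eq_of_src (𝟙 _) 0, Abelian.Ext.mk₀_zero, Abelian.Ext.comp_zero]

theorem seq_of_crit [IsNoetherianRing R] [IsLocalRing R] [Module.Finite R M]
    (h : DimCrit R M) : IsSeqCM R (IsLocalRing.maximalIdeal R) M := by
  have main : ∀ n : ℕ, ∃ (r : ℕ) (F : ℕ → Submodule R M),
      F 0 = ⊥ ∧ F r = dimSub R M n ∧ (∀ i < r, F i < F (i + 1)) ∧
    (∀ i < r, IsCM R (IsLocalRing.maximalIdeal R) (subQuot R (F i) (F (i + 1)))) ∧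
    (∀ i, i + 1 < r →
      mDim R (subQuot R (F i) (F (i + 1))) < mDim R (subQuot R (F (i + 1)) (F (i + 2)))) ∧
    (∀ i < r, mDim R (subQuot R (F i) (F (i + 1))) < (n : ℕ∞)) := by
    intro n
    induction n with
    | zero =>
      refine ⟨0, fun _ => ⊥, rfl, ?_, ?_, ?_, ?_, ?_⟩
      · exact (dimSub_zero (R := R) (M := M)).symm
      all_goals intros; omega
    | succ n ih =>
      obtain ⟨r, F, h0, hr, hlt, hcm, hdim, hbd⟩ := ih
      have hmono : dimSub R M n ≤ dimSub R M ((n + 1 : ℕ) : ℕ∞) :=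
        dimSub_mono (by exact_mod_cast Nat.le_succ n)
      have hnn : ((n : ℕ∞) : WithBot ℕ∞) < ((n + 1 : ℕ) : ℕ∞) := by
        rw [WithBot.coe_lt_coe, Nat.cast_lt]; omega
      by_cases heq : dimSub R M ((n + 1 : ℕ) : ℕ∞) ≤ dimSub R M n
      · exact ⟨r, F, h0, hr.trans (le_antisymm hmono heq), hlt, hcm, hdim,
          fun i hi => (hbd i hi).trans hnn⟩
      · obtain ⟨hC, hD⟩ := dimQ_CM n (h n) (subQuot_nontrivial heq)
        let G : ℕ → Submodule R M := fun i => if i ≤ r then F i else dimSub R M ((n + 1 : ℕ) : ℕ∞)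
        have G1 : ∀ i ≤ r, G i = F i := fun i hi => if_pos hi
        have G2 : G (r + 1) = dimSub R M ((n + 1 : ℕ) : ℕ∞) := if_neg (by omega)
        refine ⟨r + 1, G, ?_, G2, ?_, ?_, ?_, ?_⟩
        · rw [G1 0 (by omega), h0]
        · intro i hi
          rcases Nat.lt_succ_iff_lt_or_eq.1 hi with hi | rfl
          · rw [G1 i hi.le, G1 (i + 1) hi]; exact hlt i hi
          · rw [G1 i le_rfl, G2, hr]; exact lt_of_le_not_ge hmono heq
        · intro i hi
          rcases Nat.lt_succ_iff_lt_or_eq.1 hi with hi | rfl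
          · rw [G1 i hi.le, G1 (i + 1) hi]; exact hcm i hi
          · rw [G1 i le_rfl, G2, hr]; exact hC
        · intro i hi
          rcases Nat.lt_succ_iff_lt_or_eq.1 hi with hi | rfl
          · rw [G1 i (by omega), G1 (i + 1) hi.le, G1 (i + 2) hi]; exact hdim i hi
          · rw [G1 i (by omega), G1 (i + 1) le_rfl, G2]
            refine (hbd i (by omega)).trans_le ?_
            rw [hr]; exact hD.ge
        · intro i hi
          rcases Nat.lt_succ_iff_lt_or_eq.1 hi with hi | rfl
          · rw [G1 i hi.le, G1 (i + 1) hi]; exact (hbd i hi).trans hnn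
          · rw [G1 i le_rfl, G2, hr]; exact hD.trans_lt hnn
  have hfin : ∃ n : ℕ, dimSub R M n = ⊤ := by
    have hf : ringKrullDim R < ⊤ := ringKrullDim_lt_top
    obtain ⟨n, hn⟩ : ∃ n : ℕ, ringKrullDim R < ((n : ℕ∞) : WithBot ℕ∞) := by
      have hb : ringKrullDim R ≠ ⊥ := ringKrullDim_ne_bot
      obtain ⟨e, he⟩ := WithBot.ne_bot_iff_exists.1 hb
      rw [← he] at hf ⊢
      have : e ≠ ⊤ := by rintro rfl; exact lt_irrefl _ hf
      obtain ⟨m, rfl⟩ := ENat.ne_top_iff_exists.1 this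
      exact ⟨m + 1, by rw [WithBot.coe_lt_coe, Nat.cast_lt]; omega⟩
    refine ⟨n, dimSub_eq_top (lt_of_le_of_lt ?_ hn)⟩
    exact Order.krullDim_le_of_strictMono (fun p : Module.support R M => p.1) (fun _ _ h => h)
  obtain ⟨n, hn⟩ := hfin
  obtain ⟨r, F, h0, hr, hlt, hcm, hdim, -⟩ := main n
  exact ⟨r, F, h0, hr.trans hn, hlt, hcm, hdim⟩

theorem fil_eq [IsNoetherianRing R] [IsLocalRing R] [Module.Finite R M] {r : ℕ}
    {F : ℕ → Submodule R M} (hF : IsSCMFil R (IsLocalRing.maximalIdeal R) r F) (c j : ℕ)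
    (hj : j ≤ r) (h1 : ∀ i < j, mDepth R (IsLocalRing.maximalIdeal R) (subQuot R (F i) (F (i + 1))) < c)
    (h2 : ∀ i, j ≤ i → i < r →
      (c : ℕ∞) ≤ mDepth R (IsLocalRing.maximalIdeal R) (subQuot R (F i) (F (i + 1)))) :
    dimSub R M c = F j := by
  obtain ⟨h0, hr, hlt, hcm, hdim⟩ := hF
  apply le_antisymm
  · refine Nat.decreasingInduction' (P := fun i => dimSub R M c ≤ F i) ?_ hj (by rw [hr]; exact le_top)
    intro i hi hji ih m hm
    have hbot := dimSub_eq_bot ((le_mDepth_iff _ _ _ _).1 (h2 i hji hi))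
    have : (Submodule.Quotient.mk ⟨m, ih hm⟩ : subQuot R (F i) (F (i + 1))) ∈ dimSub R _ c := by
      intro p hp
      obtain ⟨s, hs, h⟩ := hm p hp
      refine ⟨s, hs, ?_⟩
      rw [← Submodule.Quotient.mk_smul, Submodule.Quotient.mk_eq_zero, Submodule.mem_comap]
      change s • m ∈ F i
      rw [h]; exact zero_mem _
    rw [hbot, Submodule.mem_bot, Submodule.Quotient.mk_eq_zero, Submodule.mem_comap] at this
    exact this
  · have : ∀ i ≤ j, F i ≤ dimSub R M c := by
      intro i
      induction i with
      | zero => intro _; rw [h0]; exact bot_le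
      | succ i ih =>
        intro hi m hm p hp
        have hd : mDim R (subQuot R (F i) (F (i + 1))) < (c : ℕ∞) := by
          rw [← (hcm i (by omega)).2, WithBot.coe_lt_coe]; exact h1 i (by omega)
        have htop := dimSub_eq_top hd
        have hmem : (Submodule.Quotient.mk ⟨m, hm⟩ : subQuot R (F i) (F (i + 1))) ∈ dimSub R _ c := by
          rw [htop]; trivial
        obtain ⟨s, hs, h⟩ := hmem p hp
        rw [← Submodule.Quotient.mk_smul, Submodule.Quotient.mk_eq_zero, Submodule.mem_comap] at h
        obtain ⟨t, ht, h'⟩ := ih (by omega) h p hp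
        refine ⟨t * s, fun h => (p.isPrime.mem_or_mem h).elim ht hs, ?_⟩
        rw [mul_smul]; exact h'
    exact this j le_rfl

theorem crit_of_seq [IsNoetherianRing R] [IsLocalRing R] [Module.Finite R M]
    (h : IsSeqCM R (IsLocalRing.maximalIdeal R) M) : DimCrit R M := by
  obtain ⟨r, F, hF⟩ := h
  have hF' := hF
  obtain ⟨h0, hr, hlt, hcm, hdim⟩ := hF'
  let e : ℕ → ℕ∞ := fun i => mDepth R (IsLocalRing.maximalIdeal R) (subQuot R (F i) (F (i + 1)))
  have hstep : ∀ i, i + 1 < r → e i < e (i + 1) := by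
    intro i hi
    have := hdim i hi
    rw [← (hcm i (by omega)).2, ← (hcm (i + 1) hi).2, WithBot.coe_lt_coe] at this
    exact this
  have hmono : ∀ i k, i ≤ k → k < r → e i ≤ e k := by
    intro i k hik
    induction k, hik using Nat.le_induction with
    | base => intro _; exact le_rfl
    | succ k hk ih => intro hkr; exact (ih (by omega)).trans (hstep k hkr).le
  intro c
  have hex : ∃ j, j = r ∨ (c : ℕ∞) ≤ e j := ⟨r, Or.inl rfl⟩
  classical
  obtain ⟨j, hjr, hj, hj1⟩ : ∃ j, j ≤ r ∧ (j = r ∨ (c : ℕ∞) ≤ e j) ∧ ∀ i < j, e i < c := by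
    refine ⟨Nat.find hex, Nat.find_min' hex (Or.inl rfl), Nat.find_spec hex, fun i hi => ?_⟩
    have := Nat.find_min hex hi
    push Not at this
    exact this.2
  have hlow : ∀ d : ℕ, (j < r → (d : ℕ∞) ≤ e j) → ∀ i, j ≤ i → i < r → (d : ℕ∞) ≤ e i :=
    fun d hd i hji hir => (hd (by omega)).trans (hmono j i hji hir)
  have hDc : dimSub R M c = F j := by
    refine fil_eq hF c j hjr hj1 (hlow c fun hjr' => ?_)
    rcases hj with hj | hj
    · omega
    · exact hj
  have hcc : ∀ a : ℕ∞, a < c → a < ((c + 1 : ℕ) : ℕ∞) := fun a ha =>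
    ha.trans (by rw [Nat.cast_lt]; omega)
  intro i hi
  by_cases hcase : j < r ∧ e j = c
  · have hDc' : dimSub R M ((c + 1 : ℕ) : ℕ∞) = F (j + 1) := by
      refine fil_eq hF (c + 1) (j + 1) hcase.1 ?_ ?_
      · intro i hi
        rcases Nat.lt_succ_iff_lt_or_eq.1 hi with hi | rfl
        · exact hcc _ (hj1 i hi)
        · change e i < _
          rw [hcase.2, Nat.cast_lt]; omega
      · intro i hji hir
        have h3 := (hstep j (by omega)).trans_le (hmono (j + 1) i hji hir)
        rw [hcase.2] at h3
        push_cast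
        exact Order.add_one_le_of_lt h3
    unfold dimQ
    rw [hDc, hDc']
    exact (le_mDepth_iff _ _ _ c).1 hcase.2.ge i hi
  · have hDc' : dimSub R M ((c + 1 : ℕ) : ℕ∞) = F j := by
      refine fil_eq hF (c + 1) j hjr (fun i hi => hcc _ (hj1 i hi)) (hlow (c + 1) fun hjr' => ?_)
      push_cast
      apply Order.add_one_le_of_lt
      refine lt_of_le_of_ne (hj.resolve_left (by omega)) fun h => hcase ⟨hjr', h.symm⟩
    apply extC_of_sub
    apply subQuot_subsingleton
    rw [hDc, hDc']

end

open IsLocalRing in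
/-- Let `R` be a Cohen-Macaulay Noetherian local ring with canonical module
`ω`, and let `M`, `N` be finitely generated `R`-modules.  Then `M` and `N` are both
sequentially Cohen-Macaulay if and only if `M ⊕ N` is sequentially Cohen-Macaulay. -/
theorem stmt13 (R : Type) [CommRing R] [IsNoetherianRing R] [IsLocalRing R]
    (hCMring : IsCMLocalRing R)
    (ω : Type) [AddCommGroup ω] [Module R ω] (hω : IsCanonicalModule R ω)
    (M : Type) [AddCommGroup M] [Module R M] [Module.Finite R M]
    (N : Type) [AddCommGroup N] [Module R N] [Module.Finite R N] :
    (IsSeqCM R (maximalIdeal R) M ∧ IsSeqCM R (maximalIdeal R) N) ↔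
      IsSeqCM R (maximalIdeal R) (M × N) := by
  constructor
  · rintro ⟨h1, h2⟩
    exact seq_of_crit (dimCrit_prod.1 ⟨crit_of_seq h1, crit_of_seq h2⟩)
  · intro h
    obtain ⟨h1, h2⟩ := dimCrit_prod.2 (crit_of_seq h)
    exact ⟨seq_of_crit h1, seq_of_crit h2⟩
end
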